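/- arXiv:1510.03670 — 5 statements merged into one kernel-verified Lean document; each statement's English description precedes it below -/
import Mathlib

section
/- Let x^{α1}y^{β1} and x^{α2}y^{β2} be monomials of F[x,y] with α1 ≤ q and α2 ≤ q. Then x^{α1}y^{β1} ≺ x^{α2}y^{β2} if and only if α1·q + β1·(q+1) < α2·q + β2·(q+1). Consequently, on polynomials of x-degree at most q, the leading monomial for ≺ coincides with the leading monomial for the weighted order with weights w(x)=q, w(y)=q+1. -/
open MvPolynomial

noncomputable section

/-- The monomial `x^r y^s` in `F[x,y]`, where `x = X 0`, `y = X 1`. -/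
def monoXY (F : Type) [Field F] (r s : ℕ) : MvPolynomial (Fin 2) F := X 0 ^ r * X 1 ^ s

/-- The Hermitian polynomial `H = x^(q+1) - y^q - y`. -/
def Hpoly (F : Type) [Field F] (q : ℕ) : MvPolynomial (Fin 2) F :=
  X 0 ^ (q + 1) - X 1 ^ q - X 1

/-- Evaluation of a bivariate polynomial at a point of `F × F`. -/
def evalPt {F : Type} [Field F] (p : F × F) (f : MvPolynomial (Fin 2) F) : F :=
  MvPolynomial.eval ![p.1, p.2] f

/-- The vanishing ideal of a set of points `S ⊆ F × F`. -/
def vanIdeal (F : Type) [Field F] (S : Set (F × F)) : Ideal (MvPolynomial (Fin 2) F) where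
  carrier := {f | ∀ p ∈ S, evalPt p f = 0}
  add_mem' := by
    intro a b ha hb p hp
    have h1 := ha p hp
    have h2 := hb p hp
    simp only [evalPt] at h1 h2 ⊢
    simp [map_add, h1, h2]
  zero_mem' := by
    intro p hp
    simp [evalPt]
  smul_mem' := by
    intro c f hf p hp
    have h1 := hf p hp
    simp only [evalPt] at h1 ⊢
    simp [smul_eq_mul, map_mul, h1]

/-- The `DegRevLex` order with `y > x`, on exponent pairs `(a, b) ↔ x^a y^b`. -/
def precOrd : ℕ × ℕ → ℕ × ℕ → Prop := fun a b =>
  a.1 + a.2 < b.1 + b.2 ∨ (a.1 + a.2 = b.1 + b.2 ∧ a.2 < b.2)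

/-- The pair of exponents `(d 0, d 1)` of an exponent finsupp. -/
def expPair (d : Fin 2 →₀ ℕ) : ℕ × ℕ := (d 0, d 1)

/-- `x^r y^s` is the leading monomial of `f` with respect to the monomial order `lt`. -/
def IsLMwith {F : Type} [Field F] (lt : ℕ × ℕ → ℕ × ℕ → Prop)
    (f : MvPolynomial (Fin 2) F) (r s : ℕ) : Prop :=
  MvPolynomial.coeff (Finsupp.single 0 r + Finsupp.single 1 s) f ≠ 0 ∧
    ∀ d ∈ f.support, expPair d = (r, s) ∨ lt (expPair d) (r, s)

/-- The initial ideal of `I` w.r.t. the monomial order `lt`: the ideal generated by the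
leading monomials of the nonzero elements of `I`. -/
def initialIdealWith {F : Type} [Field F] (lt : ℕ × ℕ → ℕ × ℕ → Prop)
    (I : Ideal (MvPolynomial (Fin 2) F)) : Ideal (MvPolynomial (Fin 2) F) :=
  Ideal.span {g | ∃ f ∈ I, f ≠ 0 ∧ ∃ r s, IsLMwith lt f r s ∧ g = monoXY F r s}

/-- The set `E` of `F`-rational affine points of the Hermitian curve. -/
def Eset (F : Type) [Field F] (q : ℕ) : Set (F × F) :=
  {p | p.1 ^ (q + 1) = p.2 ^ q + p.2}

/-- The set `B` of (exponent pairs of) monomials. -/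
def Bset (q : ℕ) : Set (ℕ × ℕ) :=
  {p | (p.1 ≤ q ∧ p.2 ≤ q ^ 2 - q - 1) ∨ (p.1 = 0 ∧ q ^ 2 - q ≤ p.2 ∧ p.2 ≤ q ^ 2 - 1)}

/-- The Hermitian code `C_m` (as a set of vectors), for the enumeration `P` of `E`. -/
def codeSet (F : Type) [Field F] (q m : ℕ) (P : Fin (q ^ 3) → F × F) :
    Set (Fin (q ^ 3) → F) :=
  {c | ∀ r s : ℕ, r * q + s * (q + 1) ≤ m → ∑ i, c i * ((P i).1 ^ r * (P i).2 ^ s) = 0}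

/-- The weight of a codeword: the number of nonzero entries. -/
def wt {F : Type} [Field F] {n : ℕ} (c : Fin n → F) : ℕ := {i | c i ≠ 0}.ncard

/-- The support of a codeword, as a set of points of the curve. -/
def suppPts {F : Type} [Field F] {n : ℕ} (P : Fin n → F × F) (c : Fin n → F) :
    Set (F × F) :=
  P '' {i | c i ≠ 0}

end

/-- For `x`-exponents at most `q`, the graded order agrees with the weight order `(q, q + 1)`. -/
theorem precOrd_iff_weight_lt {q : ℕ} {a b : ℕ × ℕ} (ha : a.1 ≤ q) (hb : b.1 ≤ q) :
    precOrd a b ↔ a.1 * q + a.2 * (q + 1) < b.1 * q + b.2 * (q + 1) := by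
  have key : ∀ {a b : ℕ × ℕ}, b.1 ≤ q → a.1 ≤ q → a.1 + a.2 < b.1 + b.2 →
      a.1 * q + a.2 * (q + 1) < b.1 * q + b.2 * (q + 1) := by
    intro a b _ _ h
    nlinarith [Nat.mul_le_mul_left q (Nat.succ_le_of_lt h)]
  unfold precOrd
  rcases lt_trichotomy (a.1 + a.2) (b.1 + b.2) with h | h | h
  · exact iff_of_true (.inl h) (key hb ha h)
  · have : q * (a.1 + a.2) = q * (b.1 + b.2) := by rw [h]
    constructor
    · rintro (h' | ⟨-, h'⟩)
      · omega
      · nlinarith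
    · intro h'
      exact .inr ⟨h, by nlinarith⟩
  · have := key ha hb h
    omega

/-- Breaking weight ties by the `y`-exponent adds nothing when the `x`-exponents are at most `q`. -/
theorem precOrd_iff_weight_lex {q : ℕ} {a b : ℕ × ℕ} (ha : a.1 ≤ q) (hb : b.1 ≤ q) :
    precOrd a b ↔ a.1 * q + a.2 * (q + 1) < b.1 * q + b.2 * (q + 1) ∨
      (a.1 * q + a.2 * (q + 1) = b.1 * q + b.2 * (q + 1) ∧ a.2 < b.2) := by
  have hab := precOrd_iff_weight_lt ha hb
  have hba := precOrd_iff_weight_lt hb ha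
  refine ⟨fun h => .inl (hab.1 h), ?_⟩
  rintro (h | ⟨h, h'⟩)
  · exact hab.2 h
  · have h1 : ¬ precOrd a b := fun H => (hab.1 H).ne h
    have h2 : ¬ precOrd b a := fun H => (hba.1 H).ne' h
    simp only [precOrd] at h1 h2
    omega

theorem stmt_1 (q : ℕ) (hq2 : 2 ≤ q) (hq : IsPrimePow q)
    (F : Type) [Field F] [Fintype F] (hF : Fintype.card F = q ^ 2) :
    (∀ α1 β1 α2 β2 : ℕ, α1 ≤ q → α2 ≤ q →
      (precOrd (α1, β1) (α2, β2) ↔ α1 * q + β1 * (q + 1) < α2 * q + β2 * (q + 1))) ∧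
    (∀ f : MvPolynomial (Fin 2) F, f ≠ 0 → MvPolynomial.degreeOf 0 f ≤ q →
      ∀ r s : ℕ, IsLMwith precOrd f r s ↔
        IsLMwith (fun a b : ℕ × ℕ =>
          a.1 * q + a.2 * (q + 1) < b.1 * q + b.2 * (q + 1) ∨
            (a.1 * q + a.2 * (q + 1) = b.1 * q + b.2 * (q + 1) ∧ a.2 < b.2)) f r s) := by
  refine ⟨fun α1 β1 α2 β2 h1 h2 => precOrd_iff_weight_lt (q := q) h1 h2, ?_⟩
  intro f _ hdeg r s
  have hx : ∀ d ∈ f.support, d 0 ≤ q := fun d hd => (monomial_le_degreeOf 0 hd).trans hdeg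
  refine and_congr_right fun hc => forall₂_congr fun d hd => or_congr_right ?_
  have hr : r ≤ q := by simpa using hx _ (mem_support_iff.2 hc)
  exact precOrd_iff_weight_lex (a := expPair d) (b := (r, s)) (hx d hd) hr
end

section
/- The initial ideal with respect to ≺ of the vanishing ideal I_E of the set E of F-rational points of the Hermitian curve is In_≺(I_E) = ⟨x^{q+1}, x·y^{q^2-q}, y^{q^2}⟩. -/
open MvPolynomial

noncomputable section

/-- The embedding of exponent pairs in a lexicographic product realizing the order `precOrd`. -/
def lexKey (p : ℕ × ℕ) : ℕ ×ₗ ℕ := toLex (p.1 + p.2, p.2)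

theorem lexKey_lt_iff (p r : ℕ × ℕ) : lexKey p < lexKey r ↔ precOrd p r := by
  simp [lexKey, precOrd, Prod.Lex.toLex_lt_toLex]

theorem precOrd_add_left {p r : ℕ × ℕ} (h : precOrd p r) (m : ℕ × ℕ) :
    precOrd (m + p) (m + r) := by
  simp only [precOrd, Prod.fst_add, Prod.snd_add] at *
  omega

theorem not_precOrd_self (p : ℕ × ℕ) : ¬ precOrd p p := by
  simp [precOrd]

theorem precOrd_trans {a b c : ℕ × ℕ} (h : precOrd a b) (h' : precOrd b c) : precOrd a c := by
  simp only [precOrd] at *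
  omega

theorem precOrd_wf : WellFounded precOrd :=
  (InvImage.wf lexKey wellFounded_lt).mono fun p r h => (lexKey_lt_iff p r).2 h

/-- The exponent finsupp attached to an exponent pair. -/
def pairExp (p : ℕ × ℕ) : Fin 2 →₀ ℕ := Finsupp.single 0 p.1 + Finsupp.single 1 p.2

theorem expPair_pairExp (p : ℕ × ℕ) : expPair (pairExp p) = p := by
  simp [expPair, pairExp]

theorem pairExp_expPair (d : Fin 2 →₀ ℕ) : pairExp (expPair d) = d := by
  ext i
  fin_cases i <;> simp [expPair, pairExp]

variable {F : Type} [Field F]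

theorem monoXY_eq_monomial (p : ℕ × ℕ) : monoXY F p.1 p.2 = monomial (pairExp p) 1 := by
  simp [monoXY, pairExp, X_pow_eq_monomial, monomial_mul]

theorem monoXY_mul (a b c d : ℕ) :
    monoXY F a b * monoXY F c d = monoXY F (a + c) (b + d) := by
  simp only [monoXY, pow_add]
  ring

variable (F) in
/-- The polynomials all of whose monomials have exponents in `S`. -/
def mspan (S : Set (ℕ × ℕ)) : Submodule F (MvPolynomial (Fin 2) F) :=
  Submodule.span F ((fun p => monoXY F p.1 p.2) '' S)

theorem mspan_mono {S T : Set (ℕ × ℕ)} (h : S ⊆ T) : mspan F S ≤ mspan F T :=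
  Submodule.span_mono (Set.image_mono h)

theorem mem_mspan_sup_of_subset {S T : Set (ℕ × ℕ)} (h : S ⊆ T)
    {N : Submodule F (MvPolynomial (Fin 2) F)} {f : MvPolynomial (Fin 2) F}
    (hf : f ∈ mspan F S ⊔ N) : f ∈ mspan F T ⊔ N := by
  have hle : mspan F S ⊔ N ≤ mspan F T ⊔ N := sup_le_sup_right (mspan_mono h) N
  exact hle hf

theorem monoXY_mem_mspan {S : Set (ℕ × ℕ)} {a b : ℕ} (h : (a, b) ∈ S) :
    monoXY F a b ∈ mspan F S :=
  Submodule.subset_span ⟨(a, b), h, rfl⟩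

theorem mem_mspan_iff {S : Set (ℕ × ℕ)} {f : MvPolynomial (Fin 2) F} :
    f ∈ mspan F S ↔ ∀ d ∈ f.support, expPair d ∈ S := by
  constructor
  · intro hf d hd
    by_contra hS
    refine mem_support_iff.1 hd ?_
    have hle : mspan F S ≤ LinearMap.ker (lcoeff F d) := by
      refine Submodule.span_le.2 ?_
      rintro _ ⟨p, hp, rfl⟩
      have hne : pairExp p ≠ d := by
        rintro rfl
        exact hS (by rwa [expPair_pairExp])
      simp [monoXY_eq_monomial, coeff_monomial, hne]
    simpa using hle hf
  · intro h
    rw [f.as_sum]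
    refine Submodule.sum_mem _ fun d hd => ?_
    have hm : monomial d (coeff d f) = coeff d f • monoXY F (expPair d).1 (expPair d).2 := by
      rw [monoXY_eq_monomial, pairExp_expPair, smul_monomial, smul_eq_mul, mul_one]
    rw [hm]
    exact Submodule.smul_mem _ _ (monoXY_mem_mspan (h d hd))

theorem coeff_pairExp_eq_zero {S : Set (ℕ × ℕ)} {f : MvPolynomial (Fin 2) F} (hf : f ∈ mspan F S)
    {p : ℕ × ℕ} (hp : p ∉ S) : coeff (pairExp p) f = 0 := by
  by_contra h
  refine hp ?_
  have := mem_mspan_iff.1 hf _ (mem_support_iff.2 h)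
  rwa [expPair_pairExp] at this

theorem monoXY_mul_mem_mspan (m k : ℕ × ℕ) {t : MvPolynomial (Fin 2) F}
    (ht : t ∈ mspan F {p | precOrd p k}) :
    monoXY F m.1 m.2 * t ∈ mspan F {p | precOrd p (m + k)} := by
  have hle : mspan F {p | precOrd p k} ≤
      (mspan F {p | precOrd p (m + k)}).comap (LinearMap.mulLeft F (monoXY F m.1 m.2)) := by
    refine Submodule.span_le.2 ?_
    rintro _ ⟨p, hp, rfl⟩
    simp only [Submodule.comap_coe, Set.mem_preimage, LinearMap.mulLeft_apply, SetLike.mem_coe,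
      monoXY_mul]
    exact monoXY_mem_mspan (precOrd_add_left hp m)
  exact hle ht

/-- `f` is monic with leading exponent pair `k`. -/
def IsMonicAt (f : MvPolynomial (Fin 2) F) (k : ℕ × ℕ) : Prop :=
  f - monoXY F k.1 k.2 ∈ mspan F {p | precOrd p k}

theorem coeff_pairExp_monoXY (p : ℕ × ℕ) : coeff (pairExp p) (monoXY F p.1 p.2) = 1 := by
  simp [monoXY_eq_monomial]

theorem IsMonicAt.isLMwith {f : MvPolynomial (Fin 2) F} {r s : ℕ} (h : IsMonicAt f (r, s)) :
    IsLMwith precOrd f r s := by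
  constructor
  · have h0 := coeff_pairExp_eq_zero h (p := (r, s)) (not_precOrd_self _)
    rw [coeff_sub, coeff_pairExp_monoXY, sub_eq_zero] at h0
    exact h0.trans_ne one_ne_zero
  · have hf : f ∈ mspan F (insert (r, s) {p | precOrd p (r, s)}) := by
      have := add_mem (mspan_mono (Set.subset_insert (r, s) _) h)
        (monoXY_mem_mspan (F := F) (Set.mem_insert (r, s) {p | precOrd p (r, s)}))
      simpa using this
    exact mem_mspan_iff.1 hf

theorem IsMonicAt.monoXY_mem_initialIdealWith {I : Ideal (MvPolynomial (Fin 2) F)}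
    {f : MvPolynomial (Fin 2) F} {r s : ℕ} (h : IsMonicAt f (r, s)) (hf : f ∈ I) :
    monoXY F r s ∈ initialIdealWith precOrd I := by
  refine Ideal.subset_span ⟨f, hf, ?_, r, s, h.isLMwith, rfl⟩
  rintro rfl
  exact h.isLMwith.1 (coeff_zero _)

/-- If `I` contains a monic element whose leading monomial divides any given monomial outside `B`,
then every monomial is congruent modulo `I` to a combination of smaller monomials of `B`. -/
theorem monoXY_mem_mspan_sup {I : Ideal (MvPolynomial (Fin 2) F)} {B : Set (ℕ × ℕ)}
    (hB : ∀ p ∉ B, ∃ f ∈ I, ∃ m k : ℕ × ℕ, IsMonicAt f k ∧ p = m + k) (p : ℕ × ℕ) :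
    monoXY F p.1 p.2 ∈
      mspan F (B ∩ {r | r = p ∨ precOrd r p}) ⊔ I.restrictScalars F := by
  induction p using precOrd_wf.induction with
  | _ p ih =>
    by_cases hp : p ∈ B
    · exact Submodule.mem_sup_left (monoXY_mem_mspan ⟨hp, Or.inl rfl⟩)
    · obtain ⟨f, hf, m, k, hk, rfl⟩ := hB p hp
      have hle : mspan F {r | precOrd r (m + k)} ≤
          mspan F (B ∩ {r | r = m + k ∨ precOrd r (m + k)}) ⊔ I.restrictScalars F := by
        refine Submodule.span_le.2 ?_
        rintro _ ⟨r, hr, rfl⟩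
        refine mem_mspan_sup_of_subset ?_ (ih r hr)
        rintro c ⟨hc, rfl | hcr⟩
        · exact ⟨hc, Or.inr hr⟩
        · exact ⟨hc, Or.inr (precOrd_trans hcr hr)⟩
      have h1 := hle (monoXY_mul_mem_mspan m k hk)
      have h2 : monoXY F m.1 m.2 * f ∈
          mspan F (B ∩ {r | r = m + k ∨ precOrd r (m + k)}) ⊔ I.restrictScalars F :=
        Submodule.mem_sup_right (I.mul_mem_left _ hf)
      have h3 := sub_mem h2 h1
      rwa [← mul_sub, sub_sub_cancel, monoXY_mul] at h3

theorem mspan_precOrd_le_sup {I : Ideal (MvPolynomial (Fin 2) F)} {B : Set (ℕ × ℕ)}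
    (hB : ∀ p ∉ B, ∃ f ∈ I, ∃ m k : ℕ × ℕ, IsMonicAt f k ∧ p = m + k) (p : ℕ × ℕ) :
    mspan F {r | precOrd r p} ≤ mspan F (B ∩ {r | precOrd r p}) ⊔ I.restrictScalars F := by
  refine Submodule.span_le.2 ?_
  rintro _ ⟨r, hr, rfl⟩
  refine mem_mspan_sup_of_subset ?_ (monoXY_mem_mspan_sup hB r)
  rintro c ⟨hc, rfl | hcr⟩
  · exact ⟨hc, hr⟩
  · exact ⟨hc, precOrd_trans hcr hr⟩

theorem mspan_sup_eq_top {I : Ideal (MvPolynomial (Fin 2) F)} {B : Set (ℕ × ℕ)}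
    (hB : ∀ p ∉ B, ∃ f ∈ I, ∃ m k : ℕ × ℕ, IsMonicAt f k ∧ p = m + k) :
    mspan F B ⊔ I.restrictScalars F = ⊤ := by
  refine eq_top_iff.2 fun f _ => ?_
  have hf : f ∈ mspan F Set.univ := mem_mspan_iff.2 fun _ _ => Set.mem_univ _
  refine (Submodule.span_le.2 ?_ : mspan F Set.univ ≤ _) hf
  rintro _ ⟨r, -, rfl⟩
  exact mem_mspan_sup_of_subset Set.inter_subset_left (monoXY_mem_mspan_sup hB r)

/-- If `I` meets the span of the monomials of `B` trivially, then no leading monomial of an element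
of `I` lies in `B`. -/
theorem IsLMwith.notMem {I : Ideal (MvPolynomial (Fin 2) F)} {B : Set (ℕ × ℕ)}
    (hB : ∀ p ∉ B, ∃ f ∈ I, ∃ m k : ℕ × ℕ, IsMonicAt f k ∧ p = m + k)
    (hI : ∀ f ∈ mspan F B, f ∈ I → f = 0) {f : MvPolynomial (Fin 2) F} (hf : f ∈ I) {r s : ℕ}
    (h : IsLMwith precOrd f r s) : (r, s) ∉ B := by
  intro hrs
  obtain ⟨hc, hsupp⟩ := h
  change coeff (pairExp (r, s)) f ≠ 0 at hc
  set c := coeff (pairExp (r, s)) f with hcdef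
  have ht : f - c • monoXY F r s ∈ mspan F {p | precOrd p (r, s)} := by
    refine mem_mspan_iff.2 fun d hd => ?_
    have hne : d ≠ pairExp (r, s) := by
      rintro rfl
      refine mem_support_iff.1 hd ?_
      rw [coeff_sub, coeff_smul, coeff_pairExp_monoXY (r, s), smul_eq_mul, mul_one, ← hcdef,
        sub_self]
    have hd' : d ∈ f.support := by
      rw [mem_support_iff] at hd ⊢
      rwa [coeff_sub, coeff_smul, monoXY_eq_monomial (r, s), coeff_monomial, if_neg hne.symm,
        smul_zero, sub_zero] at hd
    refine (hsupp d hd').resolve_left fun he => hne ?_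
    rw [← he, pairExp_expPair]
  obtain ⟨w, hw, i, hi, hwi⟩ := Submodule.mem_sup.1 (mspan_precOrd_le_sup hB _ ht)
  have hzero : c • monoXY F r s + w = 0 := by
    refine hI _ (add_mem (Submodule.smul_mem _ _ (monoXY_mem_mspan hrs))
      (mspan_mono Set.inter_subset_left hw)) ?_
    have : c • monoXY F r s + w = f - i := by
      rw [eq_sub_iff_add_eq, add_assoc, hwi]
      ring
    rw [this]
    exact sub_mem hf hi
  have hw0 := coeff_pairExp_eq_zero hw (p := (r, s)) fun h => not_precOrd_self _ h.2
  have := congrArg (coeff (pairExp (r, s))) hzero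
  rw [coeff_add, coeff_smul, coeff_pairExp_monoXY (r, s), hw0] at this
  exact hc (by simpa using this)

/-- Evaluation at the points of `S`, as a linear map. -/
def evalOn (S : Set (F × F)) : MvPolynomial (Fin 2) F →ₗ[F] (S → F) :=
  LinearMap.pi fun p => (aeval ![p.1.1, p.1.2]).toLinearMap

theorem evalOn_apply (S : Set (F × F)) (f : MvPolynomial (Fin 2) F) (p : S) :
    evalOn S f p = evalPt p.1 f := by
  simp [evalOn, evalPt, aeval_eq_eval]

theorem evalOn_eq_zero_iff (S : Set (F × F)) (f : MvPolynomial (Fin 2) F) :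
    evalOn S f = 0 ↔ f ∈ vanIdeal F S := by
  constructor
  · intro h p hp
    rw [← evalOn_apply S f ⟨p, hp⟩, h, Pi.zero_apply]
  · intro h
    ext p
    rw [evalOn_apply]
    exact h p.1 p.2

theorem evalOn_surjective [Finite F] (S : Set (F × F)) : Function.Surjective (evalOn S) := by
  classical
  intro g
  have := Fintype.ofFinite F
  have htop := map_restrict_dom_evalₗ F (Fin 2)
  let G : (Fin 2 → F) → F := fun v => if h : (v 0, v 1) ∈ S then g ⟨_, h⟩ else 0
  obtain ⟨f, -, hf⟩ := (htop ▸ Submodule.mem_top : G ∈ Submodule.map (evalₗ F (Fin 2)) _)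
  refine ⟨f, funext fun p => ?_⟩
  have := congrFun hf ![p.1.1, p.1.2]
  rw [evalOn_apply, evalPt, ← evalₗ_apply, this]
  simp [G]

theorem eq_zero_of_mem_mspan_of_mem_vanIdeal [Finite F] {S : Set (F × F)} {B : Finset (ℕ × ℕ)}
    (hcard : B.card ≤ Nat.card S)
    (hB : mspan F (B : Set (ℕ × ℕ)) ⊔ (vanIdeal F S).restrictScalars F = ⊤)
    {f : MvPolynomial (Fin 2) F} (hf : f ∈ mspan F (B : Set (ℕ × ℕ))) (hfS : f ∈ vanIdeal F S) :
    f = 0 := by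
  classical
  have := Fintype.ofFinite S
  have himg : mspan F (B : Set (ℕ × ℕ)) =
      Submodule.span F ((B.image fun p => monoXY F p.1 p.2 : Finset _) : Set _) := by
    rw [mspan, Finset.coe_image]
  have : FiniteDimensional F (mspan F (B : Set (ℕ × ℕ))) := by
    rw [himg]
    exact FiniteDimensional.span_finset F _
  have hle : Module.finrank F (mspan F (B : Set (ℕ × ℕ))) ≤ Module.finrank F (S → F) := by
    rw [Module.finrank_fintype_fun_eq_card, ← Nat.card_eq_fintype_card, himg]
    exact (finrank_span_finset_le_card _).trans (Finset.card_image_le.trans hcard)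
  let φ := (evalOn S).domRestrict (mspan F (B : Set (ℕ × ℕ)))
  have hφ : Function.Surjective φ := by
    intro g
    obtain ⟨u, rfl⟩ := evalOn_surjective S g
    obtain ⟨w, hw, i, hi, rfl⟩ := Submodule.mem_sup.1 (hB ▸ Submodule.mem_top : u ∈ _)
    refine ⟨⟨w, hw⟩, ?_⟩
    have : evalOn S i = 0 := (evalOn_eq_zero_iff S i).2 hi
    simp [φ, this]
  have hinj : Function.Injective φ :=
    (LinearMap.injective_iff_surjective_of_finrank_eq_finrank
      (hle.antisymm (LinearMap.finrank_le_finrank_of_surjective hφ))).2 hφ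
  have h0 : (⟨f, hf⟩ : mspan F (B : Set (ℕ × ℕ))) = 0 :=
    hinj (by simpa [φ] using (evalOn_eq_zero_iff S f).2 hfS)
  simpa using h0

theorem add_pow_of_card_eq_sq [Fintype F] {q : ℕ} (hq : IsPrimePow q)
    (hF : Fintype.card F = q ^ 2) (a b : F) : (a + b) ^ q = a ^ q + b ^ q := by
  obtain ⟨p, k, hp, -, rfl⟩ := hq
  obtain ⟨p', hchar⟩ := CharP.exists F
  obtain ⟨n, hp', hn⟩ := FiniteField.card F p'
  have hdvd : p' ∣ p := by
    refine hp'.dvd_of_dvd_pow (n := k * 2) ?_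
    rw [pow_mul, ← hF, hn]
    exact dvd_pow_self _ n.ne_zero
  obtain rfl := (Nat.prime_dvd_prime_iff_eq hp' hp.nat_prime).1 hdvd
  have : Fact p'.Prime := ⟨hp'⟩
  exact add_pow_char_pow a b p' k

theorem card_le_of_forall_pow_add_mul_eq_zero {q : ℕ} (hq2 : 2 ≤ q) (c : F) {A : Set F}
    (hA : ∀ t ∈ A, t ^ q + c * t = 0) : Nat.card A ≤ q := by
  classical
  let P : Polynomial F := Polynomial.X ^ q + Polynomial.C c * Polynomial.X
  have hlt : (Polynomial.C c * Polynomial.X : Polynomial F).degree <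
      (Polynomial.X ^ q : Polynomial F).degree := by
    rw [Polynomial.degree_X_pow]
    refine (Polynomial.degree_C_mul_X_le c).trans_lt ?_
    exact_mod_cast hq2
  have hdeg : P.degree = q := by
    rw [Polynomial.degree_add_eq_left_of_degree_lt hlt, Polynomial.degree_X_pow]
  have hP : P ≠ 0 := by
    intro h
    rw [h, Polynomial.degree_zero] at hdeg
    exact WithBot.bot_ne_coe hdeg
  have hsub : A ⊆ (P.roots.toFinset : Set F) := by
    intro t ht
    simp [P, hP, hA t ht]
  calc Nat.card A ≤ Nat.card (P.roots.toFinset : Set F) :=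
        Nat.card_mono (Finset.finite_toSet _) hsub
    _ = P.roots.toFinset.card := by
        rw [Nat.card_eq_card_toFinset, Finset.toFinset_coe]
    _ ≤ Multiset.card P.roots := Multiset.toFinset_card_le _
    _ ≤ P.natDegree := P.card_roots'
    _ = q := Polynomial.natDegree_eq_of_degree_eq_some hdeg

theorem le_card_Eset [Fintype F] {q : ℕ} (hq2 : 2 ≤ q) (hq : IsPrimePow q)
    (hF : Fintype.card F = q ^ 2) : q ^ 3 ≤ Nat.card (Eset F q) := by
  have hpow := add_pow_of_card_eq_sq hq hF
  have hfrob : ∀ a : F, (a ^ q) ^ q = a := fun a => by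
    rw [← pow_mul, ← sq, ← hF, FiniteField.pow_card]
  let T : F →+ F :=
    { toFun := fun y => y ^ q + y
      map_zero' := by simp [show q ≠ 0 by omega]
      map_add' := fun a b => by rw [hpow]; ring }
  let A : Set F := {t | t ^ q = t}
  have hA : Nat.card A ≤ q :=
    card_le_of_forall_pow_add_mul_eq_zero hq2 (-1) fun t ht => by
      rw [show t ^ q = t from ht]
      ring
  have hker : Nat.card T.ker ≤ q :=
    card_le_of_forall_pow_add_mul_eq_zero hq2 1 (A := (T.ker : Set F)) fun t ht => by
      rw [one_mul]
      exact ht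
  have hsub : (T.range : Set F) ⊆ A := by
    rintro _ ⟨y, rfl⟩
    change (y ^ q + y) ^ q = y ^ q + y
    rw [hpow, hfrob, add_comm]
  have hprod : Nat.card T.range * Nat.card T.ker = q ^ 2 := by
    rw [← hF, ← Nat.card_eq_fintype_card, ← AddSubgroup.index_ker, mul_comm,
      AddSubgroup.card_mul_index]
  have hrange : Nat.card T.range ≤ Nat.card A := Nat.card_mono (Set.toFinite A) hsub
  have hq0 : 0 < q := by omega
  have hkerq : Nat.card T.ker = q := by nlinarith
  have hrangeq : Nat.card T.range = q := by nlinarith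
  have hTA : (T.range : Set F) = A := by
    refine Set.eq_of_subset_of_ncard_le hsub ?_ (Set.toFinite A)
    change Nat.card A ≤ Nat.card T.range
    omega
  have hlift : ∀ x : F, ∃ y, T y = x ^ (q + 1) := fun x => by
    have : x ^ (q + 1) ∈ A := by
      change (x ^ (q + 1)) ^ q = x ^ (q + 1)
      rw [pow_succ, mul_pow, hfrob, mul_comm]
    rwa [← hTA] at this
  choose σ hσ using hlift
  let j : F × T.ker → Eset F q := fun z => ⟨(z.1, σ z.1 + z.2), by
    change z.1 ^ (q + 1) = T (σ z.1 + z.2)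
    rw [map_add, hσ, AddMonoidHom.mem_ker.1 z.2.2, add_zero]⟩
  have hj : Function.Injective j := by
    rintro ⟨x, k⟩ ⟨x', k'⟩ h
    simp only [j, Subtype.mk.injEq, Prod.mk.injEq] at h
    obtain ⟨rfl, h⟩ := h
    simpa using h
  calc q ^ 3 = Nat.card (F × T.ker) := by
        rw [Nat.card_prod, hkerq, Nat.card_eq_fintype_card, hF]; ring
    _ ≤ Nat.card (Eset F q) := Nat.card_le_card_of_injective j hj

/-- The exponent pairs of the monomials outside `⟨x^(q+1), x * y^(q^2-q), y^(q^2)⟩`. -/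
def stdExp (q : ℕ) : Finset (ℕ × ℕ) :=
  Finset.range (q + 1) ×ˢ Finset.range (q ^ 2 - q) ∪ {0} ×ˢ Finset.Ico (q ^ 2 - q) (q ^ 2)

theorem card_stdExp_le (q : ℕ) : (stdExp q).card ≤ q ^ 3 := by
  refine (Finset.card_union_le _ _).trans (le_of_eq ?_)
  have hle : q ≤ q ^ 2 := Nat.le_self_pow two_ne_zero q
  simp only [Finset.card_product, Finset.card_range, Finset.card_singleton, Nat.card_Ico]
  zify [hle, Nat.sub_le]
  ring

theorem exists_of_notMem_stdExp {q : ℕ} {p : ℕ × ℕ} (hp : p ∉ stdExp q) :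
    ∃ k ∈ ({(q + 1, 0), (1, q ^ 2 - q), (0, q ^ 2)} : Set (ℕ × ℕ)), ∃ m, p = m + k := by
  obtain ⟨a, b⟩ := p
  simp only [stdExp, Finset.mem_union, Finset.mem_product, Finset.mem_range, Finset.mem_singleton,
    Finset.mem_Ico] at hp
  rcases le_or_gt (q + 1) a with h | h
  · exact ⟨_, Or.inl rfl, (a - (q + 1), b), by ext <;> simp; omega⟩
  rcases le_or_gt (q ^ 2) b with h' | h'
  · exact ⟨_, Or.inr (Or.inr rfl), (a, b - q ^ 2), by ext <;> simp; omega⟩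
  · exact ⟨_, Or.inr (Or.inl rfl), (a - 1, b - (q ^ 2 - q)), by ext <;> simp <;> omega⟩

theorem isMonicAt_Hpoly {q : ℕ} (hq2 : 2 ≤ q) : IsMonicAt (Hpoly F q) (q + 1, 0) := by
  have h1 : monoXY F 0 q ∈ mspan F {p | precOrd p (q + 1, 0)} :=
    monoXY_mem_mspan (by simp [precOrd])
  have h2 : monoXY F 0 1 ∈ mspan F {p | precOrd p (q + 1, 0)} :=
    monoXY_mem_mspan (by simp [precOrd]; omega)
  have : Hpoly F q - monoXY F (q + 1) 0 = -monoXY F 0 q - monoXY F 0 1 := by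
    simp only [Hpoly, monoXY]
    ring
  rw [IsMonicAt, this]
  exact sub_mem (neg_mem h1) h2

theorem isMonicAt_X_one_pow_sub {n : ℕ} (hn : 2 ≤ n) :
    IsMonicAt (X 1 ^ n - X 1 : MvPolynomial (Fin 2) F) (0, n) := by
  have h1 : monoXY F 0 1 ∈ mspan F {p | precOrd p (0, n)} :=
    monoXY_mem_mspan (by simp [precOrd]; omega)
  have : (X 1 ^ n - X 1 : MvPolynomial (Fin 2) F) - monoXY F 0 n = -monoXY F 0 1 := by
    simp only [monoXY]
    ring
  rw [IsMonicAt, this]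
  exact neg_mem h1

theorem isMonicAt_X_zero_mul_pow_sub {q : ℕ} (hq2 : 2 ≤ q) :
    IsMonicAt (X 0 * (X 1 ^ q + X 1) ^ (q - 1) - X 0 : MvPolynomial (Fin 2) F)
      (1, q ^ 2 - q) := by
  obtain ⟨n, rfl⟩ : ∃ n, q = n + 2 := ⟨q - 2, by omega⟩
  have hexp : (n + 2) ^ 2 - (n + 2) = (n + 2) * (n + 1) := by
    rw [Nat.sub_eq_iff_eq_add (Nat.le_self_pow two_ne_zero _)]
    ring
  have h0 : monoXY F 1 0 ∈ mspan F {p | precOrd p (1, (n + 2) * (n + 1))} :=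
    monoXY_mem_mspan (by simp [precOrd])
  have h1 : ∀ j ∈ Finset.range (n + 1),
      ((n + 1).choose j : F) • monoXY F 1 ((n + 2) * j + (n + 1 - j)) ∈
        mspan F {p | precOrd p (1, (n + 2) * (n + 1))} := by
    intro j hj
    refine Submodule.smul_mem _ _ (monoXY_mem_mspan (Or.inl ?_))
    rw [Finset.mem_range] at hj
    obtain ⟨i, rfl⟩ : ∃ i, n = j + i := ⟨n - j, by omega⟩
    rw [show j + i + 1 - j = i + 1 by omega]
    simp only
    nlinarith [Nat.zero_le (i * j), Nat.zero_le (i * i)]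
  have h2 := sub_mem (Submodule.sum_mem _ h1) h0
  rw [IsMonicAt, hexp]
  convert h2 using 1
  rw [show n + 2 - 1 = n + 1 by omega, add_pow, Finset.sum_range_succ, mul_add, Finset.mul_sum]
  have h3 : ∀ j, (X 0 * ((X 1 ^ (n + 2)) ^ j * X 1 ^ (n + 1 - j) * ((n + 1).choose j : MvPolynomial (Fin 2) F)) :
      MvPolynomial (Fin 2) F) =
      ((n + 1).choose j : F) • monoXY F 1 ((n + 2) * j + (n + 1 - j)) := by
    intro j
    rw [smul_eq_C_mul, map_natCast, monoXY, ← pow_mul, pow_add _ (_ * _)]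
    ring
  simp only [h3]
  simp only [monoXY, Nat.choose_self, Nat.cast_one, one_smul, Nat.sub_self, add_zero, pow_zero,
    pow_one, mul_one]
  ring

theorem Hpoly_mem_vanIdeal (q : ℕ) : Hpoly F q ∈ vanIdeal F (Eset F q) := by
  intro p hp
  have hp : p.1 ^ (q + 1) = p.2 ^ q + p.2 := hp
  simp [evalPt, Hpoly, hp]

theorem X_one_pow_card_sub_mem_vanIdeal [Fintype F] (S : Set (F × F)) :
    X 1 ^ Fintype.card F - X 1 ∈ vanIdeal F S := by
  intro p _
  simp [evalPt, FiniteField.pow_card]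

theorem X_zero_mul_pow_sub_mem_vanIdeal [Fintype F] {q : ℕ} (hq2 : 2 ≤ q)
    (hF : Fintype.card F = q ^ 2) :
    X 0 * (X 1 ^ q + X 1) ^ (q - 1) - X 0 ∈ vanIdeal F (Eset F q) := by
  intro p hp
  have hp : p.1 ^ (q + 1) = p.2 ^ q + p.2 := hp
  have hexp : (q + 1) * (q - 1) + 1 = q ^ 2 := by
    obtain ⟨n, rfl⟩ : ∃ n, q = n + 1 := ⟨q - 1, by omega⟩
    rw [Nat.add_sub_cancel]
    ring
  have hx : p.1 * (p.2 ^ q + p.2) ^ (q - 1) = p.1 := by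
    rw [← hp, ← pow_mul, ← pow_succ', hexp, ← hF, FiniteField.pow_card]
  simp [evalPt, hx]

end

theorem stmt_2 (q : ℕ) (hq2 : 2 ≤ q) (hq : IsPrimePow q)
    (F : Type) [Field F] [Fintype F] (hF : Fintype.card F = q ^ 2) :
    initialIdealWith precOrd (vanIdeal F (Eset F q)) =
      Ideal.span {monoXY F (q + 1) 0, monoXY F 1 (q ^ 2 - q), monoXY F 0 (q ^ 2)} := by
  have hmonic : ∀ k ∈ ({(q + 1, 0), (1, q ^ 2 - q), (0, q ^ 2)} : Set (ℕ × ℕ)),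
      ∃ f ∈ vanIdeal F (Eset F q), IsMonicAt f k := by
    rintro k (rfl | rfl | rfl)
    · exact ⟨_, Hpoly_mem_vanIdeal q, isMonicAt_Hpoly hq2⟩
    · exact ⟨_, X_zero_mul_pow_sub_mem_vanIdeal hq2 hF, isMonicAt_X_zero_mul_pow_sub hq2⟩
    · exact ⟨_, hF ▸ X_one_pow_card_sub_mem_vanIdeal _, isMonicAt_X_one_pow_sub (by nlinarith)⟩
  have hB : ∀ p ∉ (stdExp q : Set (ℕ × ℕ)), ∃ f ∈ vanIdeal F (Eset F q),
      ∃ m k : ℕ × ℕ, IsMonicAt f k ∧ p = m + k := by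
    intro p hp
    obtain ⟨k, hk, m, hm⟩ := exists_of_notMem_stdExp hp
    obtain ⟨f, hf, hfk⟩ := hmonic k hk
    exact ⟨f, hf, m, k, hfk, hm⟩
  refine le_antisymm (Ideal.span_le.2 ?_) (Ideal.span_le.2 ?_)
  · rintro _ ⟨f, hf, -, r, s, hLM, rfl⟩
    have hrs := hLM.notMem hB (fun g hg hgI => eq_zero_of_mem_mspan_of_mem_vanIdeal
      ((card_stdExp_le q).trans (le_card_Eset hq2 hq hF)) (mspan_sup_eq_top hB) hg hgI) hf
    obtain ⟨k, hk, ⟨a, b⟩, hm⟩ := exists_of_notMem_stdExp hrs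
    obtain ⟨rfl, rfl⟩ := Prod.ext_iff.1 hm
    rw [Prod.fst_add, Prod.snd_add, ← monoXY_mul]
    refine Ideal.mul_mem_left _ _ (Ideal.subset_span ?_)
    rcases hk with rfl | rfl | rfl <;> simp
  · rintro _ (rfl | rfl | rfl)
    · obtain ⟨f, hf, hk⟩ := hmonic (q + 1, 0) (by simp)
      exact hk.monoXY_mem_initialIdealWith hf
    · obtain ⟨f, hf, hk⟩ := hmonic (1, q ^ 2 - q) (by simp)
      exact hk.monoXY_mem_initialIdealWith hf
    · obtain ⟨f, hf, hk⟩ := hmonic (0, q ^ 2) (by simp)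
      exact hk.monoXY_mem_initialIdealWith hf
end

section
/- Let f ∈ F[x,y] be a nonzero polynomial whose degree in x is at most q and whose ≺-leading monomial is LM_≺(f) = x^r y^s with s > 0. Then In_≺(⟨H, f⟩) = ⟨x^{q+1}, x^r y^s, y^{s+q}⟩. -/
open MvPolynomial

/-- The pole order at infinity of the monomial with exponent `d` on the Hermitian curve. -/
def poleWeight (q : ℕ) (d : Fin 2 →₀ ℕ) : ℕ := q * d 0 + (q + 1) * d 1

/-- The normal form modulo the Hermitian polynomial of the monomial with exponent `m`. -/
noncomputable def hermitianNormalMonomial (F : Type) [Field F] (q : ℕ) (m : Fin 2 →₀ ℕ) :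
    MvPolynomial (Fin 2) F :=
  X 0 ^ (m 0 % (q + 1)) * X 1 ^ m 1 * (X 1 ^ q + X 1) ^ (m 0 / (q + 1))

/-- The normal form modulo the Hermitian polynomial, obtained by replacing `x ^ (q + 1)` with
`y ^ q + y`. -/
noncomputable def hermitianNormalForm (F : Type) [Field F] (q : ℕ) :
    MvPolynomial (Fin 2) F →ₗ[F] MvPolynomial (Fin 2) F :=
  (basisMonomials (Fin 2) F).constr F (hermitianNormalMonomial F q)

/-- The substitution `x ↦ t ^ q`, `y ↦ t ^ (q + 1)`. -/
noncomputable def poleWeightHom (F : Type) [Field F] (q : ℕ) :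
    MvPolynomial (Fin 2) F →ₐ[F] Polynomial F :=
  aeval ![Polynomial.X ^ q, Polynomial.X ^ (q + 1)]

section HermitianNormalForm

variable {F : Type} [Field F] {q : ℕ}

theorem monomial_one_eq_X_pow_mul_X_pow (m : Fin 2 →₀ ℕ) :
    monomial m (1 : F) = X 0 ^ m 0 * X 1 ^ m 1 := by
  rw [monomial_eq, Finsupp.prod_fintype _ _ (by simp)]
  simp

theorem Hpoly_eq_monomial : Hpoly F q = monomial (Finsupp.single 0 (q + 1)) 1 -
    monomial (Finsupp.single 1 q) 1 - monomial (Finsupp.single 1 1) 1 := by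
  rw [Hpoly, X_pow_eq_monomial, X_pow_eq_monomial]
  rfl

theorem poleWeight_add (d e : Fin 2 →₀ ℕ) :
    poleWeight q (d + e) = poleWeight q d + poleWeight q e := by
  simp only [poleWeight, Finsupp.add_apply]; ring

theorem poleWeight_eq_cases {a b c d : ℕ} (ha : a ≤ q) (hc : c ≤ q + q)
    (h : q * a + (q + 1) * b = q * c + (q + 1) * d) :
    (a = c ∧ b = d) ∨ (c = a + (q + 1) ∧ b = d + q) := by
  rcases Nat.lt_trichotomy (a + b) (c + d) with hlt | heq | hgt
  · obtain ⟨k, hk⟩ := Nat.exists_eq_add_of_lt hlt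
    have hb : b = d + q * (k + 1) := by nlinarith
    rcases k with _ | k
    · right; constructor <;> lia
    · exfalso
      have : c + d = a + b + (k + 2) := by lia
      have h2 : q * (k + 1 + 1) = q * k + 2 * q := by ring
      lia
  · left
    have : b = d := by nlinarith
    constructor <;> lia
  · exfalso
    obtain ⟨k, hk⟩ := Nat.exists_eq_add_of_lt hgt
    have hb : d = b + q * (k + 1) := by nlinarith
    have h2 : q * (k + 1) = q * k + q := by ring
    lia

theorem eq_of_poleWeight_eq {d e : Fin 2 →₀ ℕ} (hd : d 0 ≤ q) (he : e 0 ≤ q)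
    (h : poleWeight q d = poleWeight q e) : d = e := by
  rcases poleWeight_eq_cases hd (by lia) h with h | h
  · ext i; fin_cases i
    · exact h.1
    · exact h.2
  · lia

theorem poleWeight_lt_of_precOrd {d e : Fin 2 →₀ ℕ} (he : e 0 ≤ q)
    (h : precOrd (expPair d) (expPair e)) : poleWeight q d < poleWeight q e := by
  simp only [precOrd, expPair, poleWeight] at *
  rcases h with h | h
  · obtain ⟨k, hk⟩ := Nat.exists_eq_add_of_lt h
    by_contra hcon
    have : q * (e 0 + e 1) = q * (d 0 + d 1 + k + 1) := by rw [hk]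
    have h2 : e 1 + q * (k + 1) ≤ d 1 := by nlinarith
    have h3 : q * (k + 1) = q * k + q := by ring
    lia
  · have : q * (d 0 + d 1) = q * (e 0 + e 1) := by rw [h.1]
    nlinarith

theorem precOrd_of_poleWeight_lt {d e : Fin 2 →₀ ℕ} (hd : d 0 ≤ q)
    (h : poleWeight q d < poleWeight q e) : precOrd (expPair d) (expPair e) := by
  by_contra hcon
  by_cases hde : d = e
  · simp [hde] at h
  · have : precOrd (expPair e) (expPair d) := by
      have hne : ¬ (d 0 = e 0 ∧ d 1 = e 1) := fun hh => hde <| by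
        ext i; fin_cases i
        · exact hh.1
        · exact hh.2
      simp only [precOrd, expPair] at *
      lia
    exact absurd (poleWeight_lt_of_precOrd hd this) (by lia)

theorem hermitianNormalForm_monomial (m : Fin 2 →₀ ℕ) (c : F) :
    hermitianNormalForm F q (monomial m c) = c • hermitianNormalMonomial F q m := by
  have h : monomial m c = c • basisMonomials (Fin 2) F m := by simp [smul_monomial]
  rw [h, map_smul, hermitianNormalForm, Module.Basis.constr_basis]

theorem hermitianNormalForm_eq_sum (p : MvPolynomial (Fin 2) F) :
    hermitianNormalForm F q p =
      ∑ m ∈ p.support, coeff m p • hermitianNormalMonomial F q m := by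
  conv_lhs => rw [p.as_sum]
  simp only [map_sum, hermitianNormalForm_monomial]

theorem hermitianNormalMonomial_of_le {m : Fin 2 →₀ ℕ} (hm : m 0 ≤ q) :
    hermitianNormalMonomial F q m = monomial m 1 := by
  rw [hermitianNormalMonomial, Nat.mod_eq_of_lt (by lia), Nat.div_eq_of_lt (by lia),
    monomial_one_eq_X_pow_mul_X_pow]
  simp

theorem Hpoly_dvd_sub_hermitianNormalForm (p : MvPolynomial (Fin 2) F) :
    Hpoly F q ∣ p - hermitianNormalForm F q p := by
  induction p using MvPolynomial.induction_on' with
  | monomial m c =>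
    have h : monomial m c = c • monomial m (1 : F) := by simp [smul_monomial]
    rw [hermitianNormalForm_monomial, h, ← smul_sub]
    apply dvd_smul_of_dvd
    rw [monomial_one_eq_X_pow_mul_X_pow, hermitianNormalMonomial]
    conv in X 0 ^ m 0 => rw [← Nat.mod_add_div (m 0) (q + 1), pow_add, pow_mul]
    have h1 : Hpoly F q ∣ ((X 0 : MvPolynomial (Fin 2) F) ^ (q + 1)) ^ (m 0 / (q + 1)) -
        (X 1 ^ q + X 1) ^ (m 0 / (q + 1)) := by
      have := sub_dvd_pow_sub_pow ((X 0 : MvPolynomial (Fin 2) F) ^ (q + 1)) (X 1 ^ q + X 1)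
        (m 0 / (q + 1))
      rwa [← sub_sub] at this
    convert h1.mul_left (X 0 ^ (m 0 % (q + 1)) * X 1 ^ m 1) using 1
    ring
  | add a b ha hb =>
    rw [map_add, add_sub_add_comm]
    exact dvd_add ha hb

theorem hermitianNormalForm_Hpoly_mul (p : MvPolynomial (Fin 2) F) :
    hermitianNormalForm F q (Hpoly F q * p) = 0 := by
  induction p using MvPolynomial.induction_on' with
  | monomial m c =>
    have h : Hpoly F q * monomial m c = monomial (Finsupp.single 0 (q + 1) + m) c
        - monomial (Finsupp.single 1 q + m) c - monomial (Finsupp.single 1 1 + m) c := by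
      simp only [Hpoly_eq_monomial, sub_mul, monomial_mul, one_mul]
    rw [h]
    simp only [map_sub, hermitianNormalForm_monomial, ← smul_sub, hermitianNormalMonomial]
    simp only [Finsupp.add_apply, Finsupp.single_eq_same, ne_eq, zero_ne_one, one_ne_zero,
      not_false_eq_true, Finsupp.single_eq_of_ne, zero_add, Nat.add_mod_left,
      Nat.add_div_left _ (Nat.succ_pos q)]
    rw [smul_eq_zero]; right
    ring
  | add a b ha hb => rw [mul_add, map_add, ha, hb, add_zero]

theorem hermitianNormalForm_eq_of_dvd {p p' : MvPolynomial (Fin 2) F}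
    (h : Hpoly F q ∣ p - p') : hermitianNormalForm F q p = hermitianNormalForm F q p' := by
  obtain ⟨u, hu⟩ := h
  rw [← sub_eq_zero, ← map_sub, hu, hermitianNormalForm_Hpoly_mul]

theorem le_of_mem_support_hermitianNormalMonomial {m d : Fin 2 →₀ ℕ}
    (hd : d ∈ (hermitianNormalMonomial F q m).support) (hq : 0 < q) :
    d 0 ≤ m 0 % (q + 1) ∧ d 1 ≤ m 1 + q * (m 0 / (q + 1)) := by
  constructor
  · refine (monomial_le_degreeOf 0 hd).trans ?_
    refine (degreeOf_mul_le _ _ _).trans ?_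
    have h1 := degreeOf_mul_le 0 (X 0 ^ (m 0 % (q + 1)) : MvPolynomial (Fin 2) F) (X 1 ^ m 1)
    have h2 := degreeOf_pow_le 0 (X 1 ^ q + X 1 : MvPolynomial (Fin 2) F) (m 0 / (q + 1))
    have h3 := degreeOf_add_le 0 (X 1 ^ q : MvPolynomial (Fin 2) F) (X 1)
    rw [degreeOf_X_pow_of_ne _ (by simp), degreeOf_X_of_ne (by simp), max_self,
      Nat.le_zero] at h3
    rw [h3, mul_zero] at h2
    rw [degreeOf_X_self_pow, degreeOf_X_pow_of_ne _ (by simp)] at h1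
    lia
  · refine (monomial_le_degreeOf 1 hd).trans ?_
    refine (degreeOf_mul_le _ _ _).trans ?_
    have h1 := degreeOf_mul_le 1 (X 0 ^ (m 0 % (q + 1)) : MvPolynomial (Fin 2) F) (X 1 ^ m 1)
    have h2 := degreeOf_pow_le 1 (X 1 ^ q + X 1 : MvPolynomial (Fin 2) F) (m 0 / (q + 1))
    have h3 := degreeOf_add_le 1 (X 1 ^ q : MvPolynomial (Fin 2) F) (X 1)
    rw [degreeOf_X_self_pow, degreeOf_X_self, max_eq_left hq] at h3
    have h4 := h2.trans (Nat.mul_le_mul_left _ h3)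
    rw [mul_comm] at h4
    rw [degreeOf_X_self_pow, degreeOf_X_pow_of_ne _ (by simp)] at h1
    lia

theorem exists_of_mem_support_hermitianNormalForm {p : MvPolynomial (Fin 2) F} {d : Fin 2 →₀ ℕ}
    (hd : d ∈ (hermitianNormalForm F q p).support) :
    ∃ m ∈ p.support, d ∈ (hermitianNormalMonomial F q m).support := by
  by_contra! hcon
  rw [mem_support_iff, hermitianNormalForm_eq_sum, coeff_sum] at hd
  refine hd (Finset.sum_eq_zero fun m hm => ?_)
  rw [coeff_smul, notMem_support_iff.1 (hcon m hm), smul_zero]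

theorem poleWeight_le_of_mem_support {m d : Fin 2 →₀ ℕ} (hq : 0 < q)
    (hd : d ∈ (hermitianNormalMonomial F q m).support) : poleWeight q d ≤ poleWeight q m := by
  obtain ⟨h0, h1⟩ := le_of_mem_support_hermitianNormalMonomial hd hq
  have h := Nat.mod_add_div (m 0) (q + 1)
  calc poleWeight q d ≤ q * (m 0 % (q + 1)) + (q + 1) * (m 1 + q * (m 0 / (q + 1))) := by
        unfold poleWeight; gcongr
    _ = q * (m 0 % (q + 1) + (q + 1) * (m 0 / (q + 1))) + (q + 1) * m 1 := by ring
    _ = poleWeight q m := by rw [h, poleWeight]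

theorem hermitianNormalForm_le {p : MvPolynomial (Fin 2) F} {d : Fin 2 →₀ ℕ} (hq : 0 < q)
    (hd : d ∈ (hermitianNormalForm F q p).support) : d 0 ≤ q := by
  obtain ⟨m, -, hm⟩ := exists_of_mem_support_hermitianNormalForm hd
  exact (le_of_mem_support_hermitianNormalMonomial hm hq).1.trans
    (Nat.lt_succ_iff.1 (Nat.mod_lt _ (Nat.succ_pos q)))

theorem add_lt_of_mem_support {m d : Fin 2 →₀ ℕ} (hq : 0 < q) (hm : q < m 0)
    (hd : d ∈ (hermitianNormalMonomial F q m).support) : d 0 + d 1 < m 0 + m 1 := by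
  obtain ⟨h0, h1⟩ := le_of_mem_support_hermitianNormalMonomial hd hq
  have h := Nat.mod_add_div (m 0) (q + 1)
  have hpos : 0 < m 0 / (q + 1) := Nat.div_pos hm (Nat.succ_pos q)
  rw [add_mul] at h
  lia

/-- Passing to the normal form preserves a leading monomial which is already in normal form. -/
theorem IsLMwith.hermitianNormalForm {g : MvPolynomial (Fin 2) F} {a b : ℕ} (hq : 0 < q)
    (ha : a ≤ q) (h : IsLMwith precOrd g a b) :
    IsLMwith precOrd (hermitianNormalForm F q g) a b := by
  set e : Fin 2 →₀ ℕ := Finsupp.single 0 a + Finsupp.single 1 b with he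
  have he0 : e 0 = a := by simp [he]
  have he1 : e 1 = b := by simp [he]
  have key : ∀ m ∈ g.support, m ≠ e → ∀ d ∈ (hermitianNormalMonomial F q m).support,
      precOrd (expPair d) (a, b) := by
    intro m hm hme d hd
    have hlt : precOrd (expPair m) (a, b) := by
      rcases h.2 m hm with h' | h'
      · refine absurd ?_ hme
        simp only [expPair, Prod.mk.injEq] at h'
        ext i; fin_cases i
        · exact h'.1.trans he0.symm
        · exact h'.2.trans he1.symm
      · exact h'
    by_cases hmq : m 0 ≤ q
    · rw [hermitianNormalMonomial_of_le hmq] at hd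
      have := Finset.mem_singleton.1 (support_monomial_subset hd)
      rwa [this]
    · have := add_lt_of_mem_support hq (by lia) hd
      simp only [precOrd, expPair] at *
      lia
  constructor
  · rw [hermitianNormalForm_eq_sum, coeff_sum, Finset.sum_eq_single e]
    · rw [hermitianNormalMonomial_of_le (by lia)]
      simpa [he] using h.1
    · intro m hm hme
      have hnot : e ∉ (hermitianNormalMonomial F q m).support := fun hcon => by
        have := key m hm hme _ hcon
        simp only [precOrd, expPair] at this
        lia
      rw [coeff_smul, notMem_support_iff.1 hnot, smul_zero]
    · intro hcon
      exact absurd (mem_support_iff.2 h.1) hcon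
  · intro d hd
    obtain ⟨m, hm, hdm⟩ := exists_of_mem_support_hermitianNormalForm hd
    by_cases hme : m = e
    · left
      rw [hme, hermitianNormalMonomial_of_le (by lia)] at hdm
      have := Finset.mem_singleton.1 (support_monomial_subset hdm)
      rw [this, expPair, he0, he1]
    · exact Or.inr (key m hm hme d hdm)

theorem poleWeightHom_monomial (m : Fin 2 →₀ ℕ) (c : F) :
    poleWeightHom F q (monomial m c) = Polynomial.monomial (poleWeight q m) c := by
  have h : monomial m c = c • monomial m (1 : F) := by simp [smul_monomial]
  rw [h, map_smul, monomial_one_eq_X_pow_mul_X_pow, poleWeightHom]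
  simp only [map_mul, map_pow, aeval_X, Matrix.cons_val_zero, Matrix.cons_val_one, ← pow_mul,
    ← pow_add]
  rw [← mul_one c, ← smul_eq_mul, ← Polynomial.smul_monomial, Polynomial.X_pow_eq_monomial,
    smul_eq_mul, mul_one]
  rfl

theorem poleWeightHom_eq_sum (p : MvPolynomial (Fin 2) F) :
    poleWeightHom F q p =
      ∑ m ∈ p.support, Polynomial.monomial (poleWeight q m) (coeff m p) := by
  conv_lhs => rw [p.as_sum]
  simp only [map_sum, poleWeightHom_monomial]

theorem natDegree_poleWeightHom_le {p : MvPolynomial (Fin 2) F} {n : ℕ}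
    (h : ∀ d ∈ p.support, poleWeight q d ≤ n) : (poleWeightHom F q p).natDegree ≤ n := by
  rw [poleWeightHom_eq_sum]
  exact Polynomial.natDegree_sum_le_of_forall_le _ _ fun m hm =>
    (Polynomial.natDegree_monomial_le _).trans (h m hm)

theorem exists_of_coeff_poleWeightHom_ne_zero {p : MvPolynomial (Fin 2) F} {n : ℕ}
    (h : (poleWeightHom F q p).coeff n ≠ 0) : ∃ d ∈ p.support, poleWeight q d = n := by
  rw [poleWeightHom_eq_sum, Polynomial.finsetSum_coeff] at h
  obtain ⟨d, hd, hne⟩ := Finset.exists_ne_zero_of_sum_ne_zero h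
  refine ⟨d, hd, ?_⟩
  by_contra hcon
  exact hne (Polynomial.coeff_monomial_of_ne _ (Ne.symm hcon))

theorem coeff_poleWeightHom {p : MvPolynomial (Fin 2) F} (h : ∀ d ∈ p.support, d 0 ≤ q)
    {e : Fin 2 →₀ ℕ} (he : e ∈ p.support) :
    (poleWeightHom F q p).coeff (poleWeight q e) = coeff e p := by
  rw [poleWeightHom_eq_sum, Polynomial.finsetSum_coeff, Finset.sum_eq_single_of_mem e he]
  · simp
  · intro d hd hde
    refine Polynomial.coeff_monomial_of_ne _ fun hcon => hde ?_
    exact eq_of_poleWeight_eq (h d hd) (h e he) hcon.symm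

theorem coeff_poleWeightHom_hermitianNormalMonomial (hq : 2 ≤ q) (m : Fin 2 →₀ ℕ) :
    (poleWeightHom F q (hermitianNormalMonomial F q m)).coeff (poleWeight q m) = 1 := by
  have h : ((Polynomial.X ^ (q + 1)) ^ q + Polynomial.X ^ (q + 1) : Polynomial F).Monic := by
    rw [← pow_mul]
    refine Polynomial.monic_X_pow_add ?_
    rw [Polynomial.degree_X_pow]
    exact_mod_cast (by nlinarith : q + 1 < (q + 1) * q)
  have hdeg : ((Polynomial.X ^ (q + 1)) ^ q + Polynomial.X ^ (q + 1) :
      Polynomial F).natDegree = (q + 1) * q := by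
    rw [← pow_mul]
    rw [Polynomial.natDegree_add_eq_left_of_natDegree_lt] <;>
      simp only [Polynomial.natDegree_X_pow]
    nlinarith
  have hΦ : poleWeightHom F q (hermitianNormalMonomial F q m) =
      (Polynomial.X ^ q) ^ (m 0 % (q + 1)) * (Polynomial.X ^ (q + 1)) ^ m 1 *
        ((Polynomial.X ^ (q + 1)) ^ q + Polynomial.X ^ (q + 1)) ^ (m 0 / (q + 1)) := by
    simp [poleWeightHom, hermitianNormalMonomial]
  have hX : ∀ k, (Polynomial.X ^ k : Polynomial F).Monic := Polynomial.monic_X_pow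
  have hmon : (poleWeightHom F q (hermitianNormalMonomial F q m)).Monic := by
    rw [hΦ]
    exact (((hX _).pow _).mul ((hX _).pow _)).mul (h.pow _)
  have hnd : (poleWeightHom F q (hermitianNormalMonomial F q m)).natDegree = poleWeight q m := by
    rw [hΦ, (((hX _).pow _).mul ((hX _).pow _)).natDegree_mul (h.pow _),
      ((hX _).pow _).natDegree_mul ((hX _).pow _), (hX _).natDegree_pow, (hX _).natDegree_pow,
      h.natDegree_pow, hdeg, Polynomial.natDegree_X_pow, Polynomial.natDegree_X_pow, poleWeight]
    conv_rhs => rw [← Nat.mod_add_div (m 0) (q + 1)]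
    ring
  rw [← hnd]
  exact hmon

theorem coeff_poleWeightHom_hermitianNormalForm (hq : 2 ≤ q) {p : MvPolynomial (Fin 2) F} {n : ℕ}
    (h : ∀ d ∈ p.support, poleWeight q d ≤ n) :
    (poleWeightHom F q (hermitianNormalForm F q p)).coeff n =
      (poleWeightHom F q p).coeff n := by
  rw [hermitianNormalForm_eq_sum, poleWeightHom_eq_sum p, map_sum, Polynomial.finsetSum_coeff,
    Polynomial.finsetSum_coeff]
  refine Finset.sum_congr rfl fun m hm => ?_
  rw [map_smul, Polynomial.coeff_smul, smul_eq_mul]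
  rcases (h m hm).lt_or_eq with hlt | heq
  · rw [Polynomial.coeff_monomial_of_ne _ hlt.ne', Polynomial.coeff_eq_zero_of_natDegree_lt,
      mul_zero]
    exact (natDegree_poleWeightHom_le fun d hd =>
      poleWeight_le_of_mem_support (by lia) hd).trans_lt hlt
  · rw [← heq, coeff_poleWeightHom_hermitianNormalMonomial hq, Polynomial.coeff_monomial_same,
      mul_one]

/-- The pole order is additive on products of polynomials in normal form. -/
theorem poleWeight_hermitianNormalForm_mul (hq : 2 ≤ q) {v f : MvPolynomial (Fin 2) F}
    (hv : ∀ d ∈ v.support, d 0 ≤ q) (hf : ∀ d ∈ f.support, d 0 ≤ q)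
    {c e : Fin 2 →₀ ℕ} (hc : c ∈ v.support) (he : e ∈ f.support)
    (hcmax : ∀ d ∈ v.support, poleWeight q d ≤ poleWeight q c)
    (hemax : ∀ d ∈ f.support, poleWeight q d ≤ poleWeight q e) :
    (∀ d ∈ (hermitianNormalForm F q (v * f)).support,
      poleWeight q d ≤ poleWeight q c + poleWeight q e) ∧
    ∃ d ∈ (hermitianNormalForm F q (v * f)).support,
      poleWeight q d = poleWeight q c + poleWeight q e := by
  classical
  have hmul : ∀ d ∈ (v * f).support, poleWeight q d ≤ poleWeight q c + poleWeight q e := by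
    intro d hd
    obtain ⟨a, ha, b, hb, rfl⟩ := Finset.mem_add.1 (support_mul v f hd)
    rw [poleWeight_add]
    exact add_le_add (hcmax a ha) (hemax b hb)
  constructor
  · intro d hd
    obtain ⟨m, hm, hdm⟩ := exists_of_mem_support_hermitianNormalForm hd
    exact (poleWeight_le_of_mem_support (by lia) hdm).trans (hmul m hm)
  · apply exists_of_coeff_poleWeightHom_ne_zero
    rw [coeff_poleWeightHom_hermitianNormalForm hq hmul, map_mul,
      Polynomial.coeff_mul_add_eq_of_natDegree_le (natDegree_poleWeightHom_le hcmax)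
        (natDegree_poleWeightHom_le hemax),
      coeff_poleWeightHom hv hc, coeff_poleWeightHom hf he]
    exact mul_ne_zero (mem_support_iff.1 hc) (mem_support_iff.1 he)

theorem monoXY_dvd_monoXY {a b c d : ℕ} (hac : a ≤ c) (hbd : b ≤ d) :
    monoXY F a b ∣ monoXY F c d :=
  mul_dvd_mul (pow_dvd_pow _ hac) (pow_dvd_pow _ hbd)

theorem isLMwith_Hpoly (hq : 2 ≤ q) : IsLMwith precOrd (Hpoly F q) (q + 1) 0 := by
  classical
  rw [Hpoly_eq_monomial]
  have h01 : ∀ k : ℕ,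
      (Finsupp.single 1 k : Fin 2 →₀ ℕ) ≠ Finsupp.single 0 (q + 1) := fun k hk => by
    have := DFunLike.congr_fun hk 0
    simp at this
  constructor
  · simp only [Finsupp.single_zero, add_zero, coeff_sub, coeff_monomial, h01, if_true, if_false]
    simp
  · intro d hd
    rcases Finset.mem_union.1 (support_sub _ _ _ hd) with hd | hd
    · rcases Finset.mem_union.1 (support_sub _ _ _ hd) with hd | hd
      · rw [Finset.mem_singleton.1 (support_monomial_subset hd)]
        simp [expPair]
      · rw [Finset.mem_singleton.1 (support_monomial_subset hd)]
        simp [expPair, precOrd]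
    · rw [Finset.mem_singleton.1 (support_monomial_subset hd)]
      right
      simp [expPair, precOrd]
      lia

theorem IsLMwith.ne_zero {lt : ℕ × ℕ → ℕ × ℕ → Prop} {g : MvPolynomial (Fin 2) F} {a b : ℕ}
    (h : IsLMwith lt g a b) : g ≠ 0 := by
  rintro rfl
  exact h.1 (coeff_zero _)

theorem IsLMwith.monoXY_mem {lt : ℕ × ℕ → ℕ × ℕ → Prop} {g : MvPolynomial (Fin 2) F} {a b : ℕ}
    (h : IsLMwith lt g a b) {I : Ideal (MvPolynomial (Fin 2) F)} (hg : g ∈ I) :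
    monoXY F a b ∈ initialIdealWith lt I :=
  Ideal.subset_span ⟨g, hg, h.ne_zero, a, b, h, rfl⟩

theorem IsLMwith.poleWeight_le {g : MvPolynomial (Fin 2) F} {a b : ℕ}
    (hred : ∀ d ∈ g.support, d 0 ≤ q) (h : IsLMwith precOrd g a b) :
    ∀ d ∈ g.support,
      poleWeight q d ≤ poleWeight q (Finsupp.single 0 a + Finsupp.single 1 b) := by
  intro d hd
  have hmem := mem_support_iff.2 h.1
  rcases h.2 d hd with h' | h'
  · simp only [expPair, Prod.mk.injEq] at h'
    simp [poleWeight, h'.1, h'.2]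
  · refine (poleWeight_lt_of_precOrd (hred _ hmem) ?_).le
    simpa [expPair] using h'

theorem hermitianNormalForm_mem {p : MvPolynomial (Fin 2) F} {I : Ideal (MvPolynomial (Fin 2) F)}
    (hH : Hpoly F q ∈ I) (hp : p ∈ I) : hermitianNormalForm F q p ∈ I := by
  have := I.mem_of_dvd (Hpoly_dvd_sub_hermitianNormalForm (q := q) p) hH
  simpa using I.sub_mem hp this

end HermitianNormalForm

theorem stmt_8 (q : ℕ) (hq2 : 2 ≤ q) (hq : IsPrimePow q)
    (F : Type) [Field F] [Fintype F] (hF : Fintype.card F = q ^ 2)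
    (f : MvPolynomial (Fin 2) F) (hf : f ≠ 0)
    (hdeg : MvPolynomial.degreeOf 0 f ≤ q)
    (r s : ℕ) (hs : 0 < s) (hlm : IsLMwith precOrd f r s) :
    initialIdealWith precOrd (Ideal.span {Hpoly F q, f}) =
      Ideal.span {monoXY F (q + 1) 0, monoXY F r s, monoXY F 0 (s + q)} := by
  have hq0 : 0 < q := by lia
  set e : Fin 2 →₀ ℕ := Finsupp.single 0 r + Finsupp.single 1 s with he
  have he0 : e 0 = r := by simp [he]
  have he1 : e 1 = s := by simp [he]
  have hfred : ∀ d ∈ f.support, d 0 ≤ q := fun d hd => (monomial_le_degreeOf 0 hd).trans hdeg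
  have hemem : e ∈ f.support := mem_support_iff.2 hlm.1
  have hr : r ≤ q := he0 ▸ hfred e hemem
  have hemax := hlm.poleWeight_le hfred
  have hHI : Hpoly F q ∈ Ideal.span {Hpoly F q, f} := Ideal.subset_span (by simp)
  have hfI : f ∈ Ideal.span {Hpoly F q, f} := Ideal.subset_span (by simp)
  apply le_antisymm
  · refine Ideal.span_le.2 ?_
    rintro _ ⟨g, hg, -, a, b, hab, rfl⟩
    by_cases ha : a ≤ q
    swap
    · exact Ideal.mem_of_dvd _ (monoXY_dvd_monoXY (a := q + 1) (b := 0) (by lia) (by lia))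
        (Ideal.subset_span (by simp))
    obtain ⟨u, v, rfl⟩ := Ideal.mem_span_pair.1 hg
    have hLM := hab.hermitianNormalForm hq0 ha
    have hred : hermitianNormalForm F q (u * Hpoly F q + v * f) =
        hermitianNormalForm F q (hermitianNormalForm F q v * f) := by
      apply hermitianNormalForm_eq_of_dvd
      have h1 := (Hpoly_dvd_sub_hermitianNormalForm (q := q) v).mul_right f
      convert dvd_add (dvd_mul_left (Hpoly F q) u) h1 using 1
      ring
    rw [hred] at hLM
    set v' := hermitianNormalForm F q v with hv'
    have hv'red : ∀ d ∈ v'.support, d 0 ≤ q := fun d hd => hermitianNormalForm_le hq0 hd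
    have hv'ne : v' ≠ 0 := by
      intro h0
      rw [h0, zero_mul, map_zero] at hLM
      exact hLM.ne_zero rfl
    obtain ⟨c, hc, hcmax⟩ := Finset.exists_max_image v'.support (poleWeight q)
      (Finset.nonempty_iff_ne_empty.2 (by simpa using hv'ne))
    obtain ⟨hle, d, hd, hdw⟩ := poleWeight_hermitianNormalForm_mul hq2 hv'red hfred hc hemem
      hcmax hemax
    have hab1 := hle _ (mem_support_iff.2 hLM.1)
    have hab2 := hLM.poleWeight_le (fun d hd => hermitianNormalForm_le hq0 hd) d hd
    have hw := le_antisymm hab1 (hdw ▸ hab2)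
    rw [← poleWeight_add] at hw
    have hcq := hv'red c hc
    have hcases := poleWeight_eq_cases (q := q) (a := a) (b := b) (c := c 0 + r) (d := c 1 + s)
      ha (by lia) (by simpa [poleWeight, he] using hw)
    rcases hcases with ⟨h0, h1⟩ | ⟨h0, h1⟩
    · exact Ideal.mem_of_dvd _ (monoXY_dvd_monoXY (a := r) (b := s) (by lia) (by lia))
        (Ideal.subset_span (by simp))
    · exact Ideal.mem_of_dvd _ (monoXY_dvd_monoXY (a := 0) (b := s + q) (by lia) (by lia))
        (Ideal.subset_span (by simp))
  · refine Ideal.span_le.2 ?_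
    rintro g (rfl | rfl | rfl)
    · exact (isLMwith_Hpoly hq2).monoXY_mem hHI
    · exact hlm.monoXY_mem hfI
    · rcases Nat.eq_zero_or_pos r with rfl | hrpos
      · exact Ideal.mem_of_dvd _ (monoXY_dvd_monoXY le_rfl (by lia)) (hlm.monoXY_mem hfI)
      set c : Fin 2 →₀ ℕ := Finsupp.single 0 (q + 1 - r) with hc
      have hsupp : ∀ d ∈ (monomial c (1 : F)).support, d = c := fun d hd =>
        Finset.mem_singleton.1 (support_monomial_subset hd)
      have hc0 : c 0 = q + 1 - r := by simp [hc]
      have hc1 : c 1 = 0 := by simp [hc]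
      obtain ⟨hle, d, hd, hdw⟩ := poleWeight_hermitianNormalForm_mul (c := c) hq2
        (fun d hd => by rw [hsupp d hd]; lia) hfred (by simp) hemem
        (fun d hd => by rw [hsupp d hd]) hemax
      have hdq := hermitianNormalForm_le hq0 hd
      have hd01 : d 0 = 0 ∧ d 1 = s + q := by
        rw [← poleWeight_add] at hdw
        have := poleWeight_eq_cases (c := c 0 + e 0) (d := c 1 + e 1) hdq (by lia) hdw
        lia
      have hde : d = Finsupp.single 0 0 + Finsupp.single 1 (s + q) := by
        ext i; fin_cases i
        · simp [hd01.1]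
        · simp [hd01.2]
      have hLM : IsLMwith precOrd (hermitianNormalForm F q (monomial c 1 * f)) 0 (s + q) := by
        refine ⟨hde ▸ mem_support_iff.1 hd, fun d' hd' => ?_⟩
        have hd'q := hermitianNormalForm_le hq0 hd'
        have hdp : expPair d = (0, s + q) := by rw [expPair, hd01.1, hd01.2]
        rw [← hdp]
        rcases (hdw ▸ hle d' hd' : poleWeight q d' ≤ poleWeight q d).lt_or_eq with hlt | heq
        · exact Or.inr (precOrd_of_poleWeight_lt hd'q hlt)
        · exact Or.inl (by rw [eq_of_poleWeight_eq hd'q hdq heq])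
      exact hLM.monoXY_mem (hermitianNormalForm_mem hHI (Ideal.mul_mem_left _ _ hfI))
end

section
/- Let f ∈ F[x,y] be a nonzero polynomial whose degree in x is at most q and whose ≺-leading monomial is LM_≺(f) = x^r (that is, s = 0), with 1 ≤ r ≤ q. Then In_≺(⟨H, f⟩) = ⟨x^{r}, y^{q}⟩. -/
open MvPolynomial

/-- The degree reverse lexicographic order on `F[x,y]` with `y > x`, as a `MonomialOrder`. In two
variables it is the degree lexicographic order for the reversed order of the variables. -/
noncomputable def revDegLex : MonomialOrder (Fin 2) where
  syn := DegLex ((Fin 2)ᵒᵈ →₀ ℕ)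
  toSyn := (Finsupp.domCongr OrderDual.toDual).trans
    { toEquiv := toDegLex, map_add' := toDegLex_add }
  toSyn_monotone a b h := by
    apply (MonomialOrder.degLex (σ := (Fin 2)ᵒᵈ)).toSyn_monotone
    exact fun i => h (OrderDual.ofDual i)

lemma toSyn_revDegLex_lt_iff (a b : Fin 2 →₀ ℕ) :
    revDegLex.toSyn a < revDegLex.toSyn b ↔ precOrd (expPair a) (expPair b) := by
  have key : revDegLex.toSyn a < revDegLex.toSyn b ↔
      toDegLex (Finsupp.domCongr (OrderDual.toDual (α := Fin 2)) a) <
        toDegLex (Finsupp.domCongr (OrderDual.toDual (α := Fin 2)) b) := Iff.rfl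
  have deg (c : Fin 2 →₀ ℕ) :
      (Finsupp.domCongr (OrderDual.toDual (α := Fin 2)) c).degree = c 0 + c 1 := by
    rw [Finsupp.degree_eq_sum]
    exact Fin.sum_univ_two (f := fun i : Fin 2 => c i)
  rw [key, Finsupp.DegLex.lt_iff]
  simp only [ofDegLex_toDegLex, deg, precOrd, expPair]
  refine or_congr_right (and_congr_right fun h => ?_)
  rw [Finsupp.Lex.lt_iff]
  constructor
  · rintro ⟨i, hi, hlt⟩
    induction i using OrderDual.rec with | _ i
    fin_cases i
    · have h1 : a 1 = b 1 := hi (OrderDual.toDual 1) (by decide)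
      have h0 : a 0 < b 0 := hlt
      omega
    · exact hlt
  · intro h1
    refine ⟨OrderDual.toDual 1, fun j hj => ?_, h1⟩
    induction j using OrderDual.rec with | _ j
    fin_cases j
    · exact absurd hj (by decide)
    · exact absurd hj (by decide)

/-- The exponent vector of `x^r y^s`. -/
noncomputable def expXY (r s : ℕ) : Fin 2 →₀ ℕ := Finsupp.single 0 r + Finsupp.single 1 s

@[simp] lemma expXY_zero (r s : ℕ) : expXY r s 0 = r := by simp [expXY]

@[simp] lemma expXY_one (r s : ℕ) : expXY r s 1 = s := by simp [expXY]

lemma expPair_eq_iff (d : Fin 2 →₀ ℕ) (r s : ℕ) : expPair d = (r, s) ↔ d = expXY r s := by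
  constructor
  · intro h
    simp only [expPair, Prod.mk.injEq] at h
    ext i
    fin_cases i <;> simp [h]
  · rintro rfl
    simp [expPair]

lemma expXY_le_iff (d : Fin 2 →₀ ℕ) (r s : ℕ) : expXY r s ≤ d ↔ r ≤ d 0 ∧ s ≤ d 1 := by
  simp [Finsupp.le_def, Fin.forall_fin_two]

lemma monoXY_eq_monomial_s9 (F : Type) [Field F] (r s : ℕ) :
    monoXY F r s = monomial (expXY r s) 1 := by
  simp [monoXY, expXY, X_pow_eq_monomial, monomial_mul]

lemma isLMwith_precOrd_iff {F : Type} [Field F] (f : MvPolynomial (Fin 2) F) (r s : ℕ) :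
    IsLMwith precOrd f r s ↔ f ≠ 0 ∧ revDegLex.degree f = expXY r s := by
  have pair : expPair (expXY r s) = (r, s) := (expPair_eq_iff _ _ _).2 rfl
  constructor
  · rintro ⟨hc, hle⟩
    refine ⟨fun h => hc (by simp [h]), ?_⟩
    have hf : f ≠ 0 := fun h => hc (by simp [h])
    rcases hle _ (revDegLex.degree_mem_support hf) with h | h
    · exact (expPair_eq_iff _ _ _).1 h
    · rw [← pair, ← toSyn_revDegLex_lt_iff] at h
      exact absurd (revDegLex.le_degree (mem_support_iff.2 hc)) (not_le.2 h)
  · rintro ⟨hf, hd⟩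
    refine ⟨?_, fun d hdf => ?_⟩
    · have := revDegLex.coeff_degree_ne_zero_iff.2 hf
      rwa [hd] at this
    · have hle := revDegLex.le_degree hdf
      rcases hle.eq_or_lt with h | h
      · left
        rw [expPair_eq_iff, ← hd]
        exact revDegLex.toSyn.injective h
      · right
        rwa [toSyn_revDegLex_lt_iff, hd, pair] at h

/-- Two polynomials whose leading monomials are coprime form a Gröbner basis. -/
lemma degree_le_or_degree_le_of_mem_span_pair {σ F : Type*} [Field F] (m : MonomialOrder σ)
    {f h g : MvPolynomial σ F} (hf : f ≠ 0) (hh : h ≠ 0)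
    (hcop : ∀ i, m.degree f i = 0 ∨ m.degree h i = 0)
    (hg : g ∈ Ideal.span {f, h}) (hg0 : g ≠ 0) :
    m.degree f ≤ m.degree g ∨ m.degree h ≤ m.degree g := by
  obtain ⟨a, b, rfl⟩ := Ideal.mem_span_pair.1 hg
  obtain ⟨c, b', hb, -, hb'⟩ := m.div_single (b := f)
    (isUnit_iff_ne_zero.2 (m.leadingCoeff_ne_zero_iff.2 hf)) b
  have e : a * f + b * h = (a + c * h) * f + b' * h := by rw [hb]; ring
  rw [e] at hg0 ⊢
  by_cases ha0 : a + c * h = 0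
  · rw [ha0, zero_mul, zero_add] at hg0 ⊢
    rw [m.degree_mul' hg0]
    exact Or.inr le_add_self
  by_cases hb0 : b' = 0
  · rw [hb0, zero_mul, add_zero] at hg0 ⊢
    rw [m.degree_mul' hg0]
    exact Or.inl le_add_self
  have hne : m.degree ((a + c * h) * f) ≠ m.degree (b' * h) := by
    rw [m.degree_mul ha0 hf, m.degree_mul hb0 hh]
    intro heq
    refine hb' _ (m.degree_mem_support hb0) fun i => ?_
    have hi := DFunLike.congr_fun heq i
    simp only [Finsupp.add_apply] at hi
    rcases hcop i with h0 | h0 <;> omega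
  rcases lt_or_gt_of_ne (m.toSyn.injective.ne hne) with hlt | hlt
  · rw [add_comm, m.degree_add_of_lt hlt, m.degree_mul hb0 hh]
    exact Or.inr le_add_self
  · rw [m.degree_add_of_lt hlt, m.degree_mul ha0 hf]
    exact Or.inl le_add_self

/-- If `f` has leading monomial `x^r` with `r ≤ q`, then cancelling the leading terms of `f` and
of the Hermitian polynomial leaves a polynomial with leading monomial `y^q`. -/
lemma exists_isLMwith_of_Hpoly {F : Type} [Field F] {q r : ℕ} (hq : 2 ≤ q) (hrq : r ≤ q)
    {f : MvPolynomial (Fin 2) F} (hlm : IsLMwith precOrd f r 0) :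
    ∃ h, Ideal.span {f, h} = Ideal.span {Hpoly F q, f} ∧ IsLMwith precOrd h 0 q := by
  obtain ⟨hc, hle⟩ := hlm
  set c := coeff (Finsupp.single 0 r + Finsupp.single 1 0) f with hcdef
  set k := f - C c * X 0 ^ r with hk
  have hcc : (C c * C c⁻¹ : MvPolynomial (Fin 2) F) = 1 := by
    rw [← C_mul, mul_inv_cancel₀ hc, C_1]
  have hpow : (X 0 : MvPolynomial (Fin 2) F) ^ (q + 1 - r) * X 0 ^ r = X 0 ^ (q + 1) := by
    rw [← pow_add]; congr 1; omega
  have hksupp : ∀ d ∈ k.support, d 0 + d 1 < r := by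
    intro d hd
    have hcoeff : coeff d k = coeff d f - if Finsupp.single 0 r = d then c else 0 := by
      rw [hk, coeff_sub, coeff_C_mul, coeff_X_pow]
      simp
    rw [mem_support_iff, hcoeff] at hd
    by_cases hdr : Finsupp.single 0 r = d
    · subst hdr
      simp [hcdef] at hd
    · rw [if_neg hdr, sub_zero] at hd
      rcases hle d (mem_support_iff.2 hd) with h | h
      · rw [expPair_eq_iff] at h
        exact absurd (by simp [h, expXY]) hdr
      · simp only [precOrd, expPair] at h
        omega
  refine ⟨X 0 ^ (q + 1 - r) * f - C c * Hpoly F q, ?_, ?_⟩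
  · apply le_antisymm <;> rw [Ideal.span_le] <;> rintro g (rfl | rfl)
    · exact Ideal.subset_span (by simp)
    · exact sub_mem (Ideal.mul_mem_left _ _ (Ideal.subset_span (by simp)))
        (Ideal.mul_mem_left _ _ (Ideal.subset_span (by simp)))
    · refine Ideal.mem_span_pair.2 ⟨C c⁻¹ * X 0 ^ (q + 1 - r), - C c⁻¹, ?_⟩
      linear_combination Hpoly F q * hcc
    · exact Ideal.subset_span (by simp)
  · have heq : X 0 ^ (q + 1 - r) * f - C c * Hpoly F q =
        X 0 ^ (q + 1 - r) * k + (monomial (expXY 0 q) c + monomial (expXY 0 1) c) := by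
      have h1 (s : ℕ) : monomial (expXY 0 s) c = C c * (X 1 : MvPolynomial (Fin 2) F) ^ s := by
        rw [C_mul_X_pow_eq_monomial]; simp [expXY]
      rw [h1, h1, hk, Hpoly]
      linear_combination C c * hpow
    rw [heq]
    have hxk : ∀ d ∈ (X 0 ^ (q + 1 - r) * k).support, precOrd (expPair d) (0, q) := by
      intro d hd
      rw [X_pow_eq_monomial] at hd
      obtain ⟨u, hu, v, hv, rfl⟩ := Finset.mem_add.1 (support_mul _ _ hd)
      have hu' := Finset.mem_singleton.1 (support_monomial_subset hu)
      have := hksupp v hv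
      subst hu'
      simp only [precOrd, expPair, Finsupp.add_apply, Finsupp.single_apply]
      simp
      omega
    have hq1 : expXY 0 1 ≠ expXY 0 q := fun h => by
      have := DFunLike.congr_fun h 1
      simp at this
      omega
    refine ⟨?_, fun d hd => ?_⟩
    · change coeff (expXY 0 q) _ ≠ 0
      have h0 : coeff (expXY 0 q) (X 0 ^ (q + 1 - r) * k) = 0 := by
        by_contra h
        have := hxk _ (mem_support_iff.2 h)
        simp [precOrd, expPair] at this
      simpa [h0, coeff_monomial, hq1] using hc
    · rcases Finset.mem_union.1 (support_add hd) with h | h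
      · exact Or.inr (hxk d h)
      rcases Finset.mem_union.1 (support_add h) with h | h <;>
        have hd' := Finset.mem_singleton.1 (support_monomial_subset h)
      · exact Or.inl ((expPair_eq_iff _ _ _).2 hd')
      · right
        subst hd'
        simp [precOrd, expPair]
        omega

theorem stmt_9 (q : ℕ) (hq2 : 2 ≤ q) (hq : IsPrimePow q)
    (F : Type) [Field F] [Fintype F] (hF : Fintype.card F = q ^ 2)
    (f : MvPolynomial (Fin 2) F) (hf : f ≠ 0)
    (hdeg : MvPolynomial.degreeOf 0 f ≤ q)
    (r : ℕ) (hr1 : 1 ≤ r) (hrq : r ≤ q) (hlm : IsLMwith precOrd f r 0) :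
    initialIdealWith precOrd (Ideal.span {Hpoly F q, f}) =
      Ideal.span {monoXY F r 0, monoXY F 0 q} := by
  obtain ⟨h, hspan, hlh⟩ := exists_isLMwith_of_Hpoly hq2 hrq hlm
  obtain ⟨hh0, hdh⟩ := (isLMwith_precOrd_iff _ _ _).1 hlh
  have hdf := ((isLMwith_precOrd_iff _ _ _).1 hlm).2
  rw [← hspan]
  apply le_antisymm <;> rw [initialIdealWith, Ideal.span_le]
  · rintro _ ⟨g, hg, hg0, a, b, hab, rfl⟩
    have hdg := ((isLMwith_precOrd_iff _ _ _).1 hab).2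
    have hcop : ∀ i, revDegLex.degree f i = 0 ∨ revDegLex.degree h i = 0 := by
      simp [Fin.forall_fin_two, hdf, hdh]
    have hdvd (r' s' : ℕ) (hle : expXY r' s' ≤ expXY a b) :
        monoXY F r' s' ∣ monoXY F a b := by
      rw [expXY_le_iff, expXY_zero, expXY_one] at hle
      exact mul_dvd_mul (pow_dvd_pow _ hle.1) (pow_dvd_pow _ hle.2)
    rcases degree_le_or_degree_le_of_mem_span_pair revDegLex hf hh0 hcop hg hg0 with hle | hle
    · rw [hdf, hdg] at hle
      exact Ideal.mem_of_dvd _ (hdvd _ _ hle) (Ideal.subset_span (by simp))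
    · rw [hdh, hdg] at hle
      exact Ideal.mem_of_dvd _ (hdvd _ _ hle) (Ideal.subset_span (by simp))
  · rintro _ (rfl | rfl)
    · exact Ideal.subset_span ⟨f, Ideal.subset_span (by simp), hf, r, 0, hlm, rfl⟩
    · exact Ideal.subset_span ⟨h, Ideal.subset_span (by simp), hh0, 0, q, hlh, rfl⟩
end

section
/- Let f ∈ F[x,y] be a nonzero polynomial whose degree in x is at most q and whose ≺-leading monomial is LM_≺(f) = x^r y^s. Then the quotient ring F[x,y]/⟨H, f⟩ is a finite-dimensional F-vector space of dimension exactly rq + s(q+1); equivalently, the intersection divisor cut on the affine Hermitian curve by the curve f = 0 has degree rq + s(q+1). -/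
open MvPolynomial

/-- If, for the weights `u`, the entries of `M` of maximal weighted degree are exactly those on the
graph of the permutation `τ`, then only `τ` contributes to the leading term of `M.det`. -/
theorem natDegree_det_of_weights {R n : Type*} [CommRing R] [IsDomain R] [Fintype n] [DecidableEq n]
    [Nonempty n] (M : Matrix n n (Polynomial R)) (u : n → ℕ) (v : ℕ) (τ : Equiv.Perm n)
    (hlt : ∀ i j, i ≠ τ j → M i j ≠ 0 →
      Fintype.card n * (M i j).natDegree + u i < v + u j)
    (hne : ∀ j, M (τ j) j ≠ 0)
    (heq : ∀ j, Fintype.card n * (M (τ j) j).natDegree + u (τ j) = v + u j) :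
    M.det ≠ 0 ∧ M.det.natDegree = v := by
  have hN : 0 < Fintype.card n := Fintype.card_pos
  have hu : ∀ σ : Equiv.Perm n, ∑ j, u (σ j) = ∑ j, u j := fun σ => Equiv.sum_comp σ u
  have hτ : (∏ j, M (τ j) j).natDegree = v := by
    have h := Finset.sum_congr rfl fun j (_ : j ∈ Finset.univ) => heq j
    rw [Finset.sum_add_distrib, Finset.sum_add_distrib, hu, ← Finset.mul_sum,
      Finset.sum_const, Finset.card_univ, smul_eq_mul] at h
    rw [Polynomial.natDegree_prod _ _ fun j _ => hne j]
    exact Nat.eq_of_mul_eq_mul_left hN (Nat.add_right_cancel h)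
  have hσ : ∀ σ : Equiv.Perm n, σ ≠ τ →
      ∏ j, M (σ j) j = 0 ∨ (∏ j, M (σ j) j).natDegree < v := by
    intro σ hσ
    by_cases h0 : ∏ j, M (σ j) j = 0
    · exact Or.inl h0
    right
    have h0' : ∀ j, M (σ j) j ≠ 0 := fun j => Finset.prod_ne_zero_iff.1 h0 j (Finset.mem_univ j)
    obtain ⟨j₀, hj₀⟩ : ∃ j, σ j ≠ τ j := by
      by_contra! h
      exact hσ (Equiv.ext h)
    have h : ∑ j, (Fintype.card n * (M (σ j) j).natDegree + u (σ j)) < ∑ j, (v + u j) := by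
      refine Finset.sum_lt_sum (fun j _ => ?_) ⟨j₀, Finset.mem_univ _, hlt _ _ hj₀ (h0' _)⟩
      by_cases hj : σ j = τ j
      · rw [hj, heq]
      · exact (hlt _ _ hj (h0' _)).le
    rw [Finset.sum_add_distrib, Finset.sum_add_distrib, hu, ← Finset.mul_sum,
      Finset.sum_const, Finset.card_univ, smul_eq_mul] at h
    rw [Polynomial.natDegree_prod _ _ fun j _ => h0' j]
    exact Nat.lt_of_mul_lt_mul_left (Nat.lt_of_add_lt_add_right h)
  have hcoeff : M.det.coeff v ≠ 0 := by
    rw [Matrix.det_apply, Polynomial.finsetSum_coeff, Finset.sum_eq_single τ]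
    · rw [Polynomial.coeff_smul, Units.smul_def, zsmul_eq_mul]
      refine mul_ne_zero ?_ ?_
      · rcases Int.units_eq_one_or (Equiv.Perm.sign τ) with h | h <;> simp [h]
      · rw [← hτ]
        exact Polynomial.leadingCoeff_ne_zero.2 (Finset.prod_ne_zero_iff.2 fun j _ => hne j)
    · intro σ _ h
      rw [Polynomial.coeff_smul]
      rcases hσ σ h with h | h
      · simp [h]
      · rw [Polynomial.coeff_eq_zero_of_natDegree_lt h, smul_zero]
    · exact fun h => (h (Finset.mem_univ _)).elim
  refine ⟨fun h => hcoeff (by simp [h]), Polynomial.natDegree_eq_of_le_of_coeff_ne_zero ?_ hcoeff⟩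
  rw [Matrix.det_apply]
  refine Polynomial.natDegree_sum_le_of_forall_le _ _ fun σ _ => ?_
  refine (Polynomial.natDegree_smul_le _ _).trans ?_
  by_cases h : σ = τ
  · rw [h, hτ]
  · rcases hσ σ h with h | h
    · simp [h]
    · exact h.le

theorem pow_mul_pow_fin {R S : Type*} [CommRing R] [CommRing S] [Algebra R S] {q : ℕ}
    {x : S} {p : R} (hx : x ^ (q + 1) = algebraMap R S p) (i j : Fin (q + 1)) :
    x ^ (i : ℕ) * x ^ (j : ℕ) = (if j ≤ i + j then 1 else p) • x ^ ((i + j : Fin (q + 1)) : ℕ) := by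
  have hi := i.isLt
  have hj := j.isLt
  have hadd := Fin.val_add_eq_ite i j
  rw [← pow_add]
  by_cases h : q + 1 ≤ (i : ℕ) + j
  · rw [if_pos h] at hadd
    rw [if_neg (by rw [Fin.le_def]; omega), hadd, Algebra.smul_def, ← hx, ← pow_add]
    congr 1
    omega
  · rw [if_neg h] at hadd
    rw [if_pos (by rw [Fin.le_def]; omega), hadd, one_smul]

theorem leftMulMatrix_sum_smul_pow {R S : Type*} [CommRing R] [CommRing S] [Algebra R S] {q : ℕ}
    {x : S} {p : R} (hx : x ^ (q + 1) = algebraMap R S p) (b : Module.Basis (Fin (q + 1)) R S)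
    (hb : ∀ i, b i = x ^ (i : ℕ)) (a : Fin (q + 1) → R) (k j : Fin (q + 1)) :
    Algebra.leftMulMatrix b (∑ i, a i • x ^ (i : ℕ)) k j =
      a (k - j) * (if j ≤ k then 1 else p) := by
  have hmul : ∀ i, b i * b j = (if j ≤ i + j then 1 else p) • b (i + j) := fun i => by
    simp only [hb, pow_mul_pow_fin hx]
  rw [Algebra.leftMulMatrix_eq_repr_mul, Finset.sum_mul]
  simp only [← hb, smul_mul_assoc, hmul, map_sum, map_smul, Module.Basis.repr_self,
    Finsupp.coe_finsetSum, Finset.sum_apply, Finsupp.smul_apply, smul_eq_mul]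
  rw [Finset.sum_eq_single (k - j)]
  · simp
  · intro i _ hi
    rw [Finsupp.single_eq_of_ne, mul_zero, mul_zero]
    rintro rfl
    simp at hi
  · simp

/-- The norm of `∑ aᵢ xⁱ`, where `x ^ (q + 1)` is a polynomial of degree `q` in `y`, has degree
the weight of the dominant monomial, for the weights `q` of `x` and `q + 1` of `y`. -/
theorem natDegree_norm_sum_smul_pow {F S : Type*} [Field F] [CommRing S]
    [Algebra (Polynomial F) S] {q : ℕ} {x : S} {p : Polynomial F} (hp0 : p ≠ 0)
    (hp : p.natDegree = q) (hx : x ^ (q + 1) = algebraMap (Polynomial F) S p)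
    (b : Module.Basis (Fin (q + 1)) (Polynomial F) S) (hb : ∀ i, b i = x ^ (i : ℕ))
    (a : Fin (q + 1) → Polynomial F) (r : Fin (q + 1)) (v : ℕ) (har : a r ≠ 0)
    (hr : (q + 1) * (a r).natDegree + r * q = v)
    (ha : ∀ i, i ≠ r → a i ≠ 0 → (q + 1) * (a i).natDegree + i * q < v) :
    Algebra.norm (Polynomial F) (∑ i, a i • x ^ (i : ℕ)) ≠ 0 ∧
      (Algebra.norm (Polynomial F) (∑ i, a i • x ^ (i : ℕ))).natDegree = v := by
  have hM := leftMulMatrix_sum_smul_pow hx b hb a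
  have hdeg : ∀ k j : Fin (q + 1), a (k - j) ≠ 0 →
      (q + 1) * (a (k - j) * (if j ≤ k then 1 else p)).natDegree + k * q =
        ((q + 1) * (a (k - j)).natDegree + (k - j : Fin (q + 1)) * q) + j * q := by
    intro k j h
    by_cases hjk : j ≤ k
    · have h1 : (k : ℕ) = (k - j : Fin (q + 1)) + j := by
        have := Fin.coe_sub_iff_le.2 hjk
        rw [Fin.le_def] at hjk
        omega
      rw [if_pos hjk, mul_one]
      rw [add_assoc, ← add_mul, ← h1]
    · have h1 : (k : ℕ) + (q + 1) = (k - j : Fin (q + 1)) + j := by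
        have := Fin.coe_sub_iff_lt.2 (not_le.1 hjk)
        have := j.isLt
        omega
      rw [if_neg hjk, Polynomial.natDegree_mul h hp0, hp, add_assoc _ (_ * q), ← add_mul, ← h1]
      ring
  rw [Algebra.norm_eq_matrix_det b]
  refine natDegree_det_of_weights _ (fun i : Fin (q + 1) => (i : ℕ) * q) v (Equiv.addLeft r) ?_ ?_ ?_
  · intro k j hkj hne
    rw [hM] at hne ⊢
    have h0 := left_ne_zero_of_mul hne
    rw [Fintype.card_fin, hdeg k j h0]
    refine Nat.add_lt_add_right (ha _ (fun h => hkj ?_) h0) _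
    simp [← h]
  · intro j
    rw [hM]
    refine mul_ne_zero (by simpa using har) ?_
    split_ifs
    · exact one_ne_zero
    · exact hp0
  · intro j
    have hs : Equiv.addLeft r j - j = r := by simp
    rw [hM, Fintype.card_fin, hdeg _ _ (by rwa [hs]), hs, hr]

theorem finite_quotient_span_singleton {F S ι : Type*} [Field F] [CommRing S] [IsDomain S]
    [Algebra F S] [Algebra (Polynomial F) S] [IsScalarTower F (Polynomial F) S] [Finite ι]
    (b : Module.Basis ι (Polynomial F) S) {f : S} (hf : f ≠ 0) :
    FiniteDimensional F (S ⧸ Ideal.span {f}) := by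
  classical
  have := Fintype.ofFinite ι
  have h : Ideal.span {f} ≠ ⊥ := Ideal.span_singleton_eq_bot.not.2 hf
  exact Module.Finite.equiv (Ideal.quotientEquivDirectSum F b h).symm

/-- `F[x,y]` as the ring of polynomials in `x` over `F[y]`. -/
noncomputable def polyPolyEquiv (F : Type) [Field F] :
    MvPolynomial (Fin 2) F ≃ₐ[F] Polynomial (Polynomial F) :=
  (finSuccEquiv F 1).trans (Polynomial.mapAlgEquiv (uniqueAlgEquiv F (Fin 1)))

theorem coeff_coeff_polyPolyEquiv {F : Type} [Field F] (f : MvPolynomial (Fin 2) F) (i j : ℕ) :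
    ((polyPolyEquiv F f).coeff i).coeff j =
      f.coeff (Finsupp.single 0 i + Finsupp.single 1 j) := by
  change ((Polynomial.map (uniqueAlgEquiv F (Fin 1) : MvPolynomial (Fin 1) F →+* Polynomial F)
    (finSuccEquiv F 1 f)).coeff i).coeff j = _
  rw [Polynomial.coeff_map]
  refine (coeff_uniqueAlgEquiv F _ j).trans ?_
  rw [finSuccEquiv_coeff_coeff]
  congr 1
  ext k
  fin_cases k
  · simp
  · simp [Finsupp.cons]

theorem natDegree_polyPolyEquiv {F : Type} [Field F] (f : MvPolynomial (Fin 2) F) :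
    (polyPolyEquiv F f).natDegree = degreeOf 0 f := by
  rw [← natDegree_finSuccEquiv]
  exact Polynomial.natDegree_map_eq_of_injective (uniqueAlgEquiv F (Fin 1)).injective _

theorem polyPolyEquiv_Hpoly (F : Type) [Field F] (q : ℕ) :
    polyPolyEquiv F (Hpoly F q) =
      Polynomial.X ^ (q + 1) - Polynomial.C (Polynomial.X ^ q + Polynomial.X) := by
  have h0 : polyPolyEquiv F (X 0) = Polynomial.X := by
    simp [polyPolyEquiv, finSuccEquiv_X_zero]
  have h1 : polyPolyEquiv F (X 1) = Polynomial.C Polynomial.X := by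
    have := finSuccEquiv_X_succ (R := F) (n := 1) (j := 0)
    simp only [Fin.succ_zero_eq_one] at this
    simp [polyPolyEquiv, this]
  simp [Hpoly, h0, h1, sub_sub]

theorem monic_hermitian (F : Type) [Field F] (q : ℕ) :
    (Polynomial.X ^ (q + 1) - Polynomial.C (Polynomial.X ^ q + Polynomial.X) :
      Polynomial (Polynomial F)).Monic :=
  Polynomial.monic_X_pow_sub_C _ q.succ_ne_zero

theorem irreducible_hermitian (F : Type) [Field F] {q : ℕ} (hq : 2 ≤ q) :
    Irreducible (Polynomial.X ^ (q + 1) - Polynomial.C (Polynomial.X ^ q + Polynomial.X) :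
      Polynomial (Polynomial F)) := by
  have hm := monic_hermitian F q
  have hd : (Polynomial.X ^ (q + 1) - Polynomial.C (Polynomial.X ^ q + Polynomial.X) :
      Polynomial (Polynomial F)).degree = (q + 1 : ℕ) := Polynomial.degree_X_pow_sub_C q.succ_pos _
  have hP : (Ideal.span {(Polynomial.X : Polynomial F)}).IsPrime :=
    (Ideal.span_singleton_prime Polynomial.X_ne_zero).2 Polynomial.prime_X
  refine Polynomial.irreducible_of_eisenstein_criterion hP ?_ ?_ ?_ ?_ hm.isPrimitive
  · rw [hm.leadingCoeff]
    exact fun h => hP.ne_top ((Ideal.eq_top_iff_one _).2 h)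
  · intro n hn
    rw [hd, Nat.cast_lt] at hn
    rw [Polynomial.coeff_sub, Polynomial.coeff_X_pow, if_neg hn.ne, zero_sub,
      Polynomial.coeff_C, neg_mem_iff]
    split_ifs
    · rw [Ideal.mem_span_singleton]
      exact dvd_add (dvd_pow_self _ (by omega)) dvd_rfl
    · exact zero_mem _
  · rw [hd]
    exact_mod_cast q.succ_pos
  · rw [Ideal.span_singleton_pow, Ideal.mem_span_singleton, Polynomial.X_pow_dvd_iff]
    intro h
    have := h 1 (by norm_num)
    rw [Polynomial.coeff_sub, Polynomial.coeff_X_pow, if_neg (Nat.succ_ne_zero q).symm,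
      Polynomial.coeff_C_zero] at this
    simp [Polynomial.coeff_X, Polynomial.coeff_X_pow, show (1 : ℕ) ≠ q by omega] at this

/-- If `φ : A → B` is surjective with kernel generated by `h`, then `A / (h, f) ≃ B / (φ f)`. -/
noncomputable def quotientSpanPairEquiv {R A B : Type*} [CommRing R] [CommRing A] [CommRing B]
    [Algebra R A] [Algebra R B] (φ : A →ₐ[R] B) (hφ : Function.Surjective φ) (h f : A)
    (hker : RingHom.ker φ = Ideal.span {h}) :
    (A ⧸ Ideal.span {h, f}) ≃ₐ[R] B ⧸ Ideal.span {φ f} :=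
  (Ideal.quotientEquivAlgOfEq R (by
    have hmk : RingHom.ker (Ideal.Quotient.mkₐ R (Ideal.span {φ f})) = Ideal.span {φ f} :=
      Ideal.Quotient.mkₐ_ker R _
    rw [← AlgHom.comap_ker, hmk, ← Set.image_singleton, ← Ideal.map_span,
      Ideal.comap_map_of_surjective φ hφ, ← RingHom.ker_eq_comap_bot, hker, sup_comm,
      ← Ideal.span_insert])).trans
  (Ideal.quotientKerAlgEquivOfSurjective (f := (Ideal.Quotient.mkₐ R (Ideal.span {φ f})).comp φ)
    ((Ideal.Quotient.mkₐ_surjective R _).comp hφ))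

theorem weight_lt_of_precOrd {q r s i j : ℕ} (hr : r ≤ q)
    (h : precOrd (i, j) (r, s)) : (q + 1) * j + i * q < r * q + s * (q + 1) := by
  rcases h with h | ⟨h, h'⟩
  · simp only at h
    nlinarith
  · simp only at h h'
    nlinarith

theorem stmt_10 (q : ℕ) (hq2 : 2 ≤ q) (hq : IsPrimePow q)
    (F : Type) [Field F] [Fintype F] (hF : Fintype.card F = q ^ 2)
    (f : MvPolynomial (Fin 2) F) (hf : f ≠ 0)
    (hdeg : MvPolynomial.degreeOf 0 f ≤ q)
    (r s : ℕ) (hlm : IsLMwith precOrd f r s) :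
    FiniteDimensional F (MvPolynomial (Fin 2) F ⧸ Ideal.span {Hpoly F q, f}) ∧
      Module.finrank F (MvPolynomial (Fin 2) F ⧸ Ideal.span {Hpoly F q, f}) =
        r * q + s * (q + 1) := by
  have hcoeff := coeff_coeff_polyPolyEquiv f
  have hfdeg : (polyPolyEquiv F f).natDegree < q + 1 := by
    rw [natDegree_polyPolyEquiv]
    omega
  have hweight : ∀ i j, i ≤ q → r ≤ q → (i, j) ≠ (r, s) →
      ((polyPolyEquiv F f).coeff i).coeff j ≠ 0 →
        (q + 1) * j + i * q < r * q + s * (q + 1) := by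
    intro i j hi hr hij h
    rw [hcoeff] at h
    have hp : expPair (Finsupp.single 0 i + Finsupp.single 1 j) = (i, j) := by
      simp [expPair]
    rcases hlm.2 _ (mem_support_iff.2 h) with h' | h'
    · exact absurd (hp.symm.trans h') hij
    · exact weight_lt_of_precOrd hr (hp ▸ h')
  have hrs : ((polyPolyEquiv F f).coeff r).coeff s ≠ 0 := by
    rw [hcoeff]
    exact hlm.1
  have har : (polyPolyEquiv F f).coeff r ≠ 0 := fun h => hrs (by simp [h])
  have hrq : r < q + 1 := (Polynomial.le_natDegree_of_ne_zero har).trans_lt hfdeg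
  have hnat : ((polyPolyEquiv F f).coeff r).natDegree = s := by
    refine Polynomial.natDegree_eq_of_le_of_coeff_ne_zero ?_ hrs
    by_contra! hlt
    have := hweight r _ (by omega) (by omega) (by simpa using hlt.ne')
      (Polynomial.leadingCoeff_ne_zero.2 har)
    nlinarith
  set g := polyPolyEquiv F (Hpoly F q) with hg
  have hgdef := polyPolyEquiv_Hpoly F q
  rw [← hg] at hgdef
  have hgm : g.Monic := hgdef ▸ monic_hermitian F q
  have hgd : g.natDegree = q + 1 := by
    rw [hgdef]
    exact Polynomial.natDegree_X_pow_sub_C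
  have : IsDomain (AdjoinRoot g) :=
    AdjoinRoot.isDomain_of_prime (hgdef ▸ (irreducible_hermitian F hq2).prime)
  let b := (AdjoinRoot.powerBasis' hgm).basis.reindex (finCongr hgd)
  have hb : ∀ i, b i = AdjoinRoot.root g ^ (i : ℕ) := by
    intro i
    simp only [b, Module.Basis.reindex_apply, PowerBasis.coe_basis]
    rfl
  have hx : AdjoinRoot.root g ^ (q + 1) =
      algebraMap (Polynomial F) (AdjoinRoot g) (Polynomial.X ^ q + Polynomial.X) := by
    have h := (congrArg (AdjoinRoot.mk g) hgdef).symm.trans AdjoinRoot.mk_self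
    rw [map_sub, map_pow, AdjoinRoot.mk_X, AdjoinRoot.mk_C, sub_eq_zero] at h
    exact h
  have hp : (Polynomial.X ^ q + Polynomial.X : Polynomial F).natDegree = q := by
    rw [Polynomial.natDegree_add_eq_left_of_natDegree_lt] <;> simp
    omega
  have hp0 : (Polynomial.X ^ q + Polynomial.X : Polynomial F) ≠ 0 := by
    intro h
    rw [h, Polynomial.natDegree_zero] at hp
    omega
  have hsum : AdjoinRoot.mk g (polyPolyEquiv F f) =
      ∑ i : Fin (q + 1), (polyPolyEquiv F f).coeff i • AdjoinRoot.root g ^ (i : ℕ) := by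
    conv_lhs => rw [Polynomial.as_sum_range' _ _ hfdeg]
    rw [map_sum, Finset.sum_range]
    refine Finset.sum_congr rfl fun i _ => ?_
    rw [← Polynomial.C_mul_X_pow_eq_monomial, map_mul, map_pow, AdjoinRoot.mk_X, AdjoinRoot.mk_C,
      Algebra.smul_def]
    rfl
  obtain ⟨hnorm0, hnorm⟩ := natDegree_norm_sum_smul_pow hp0 hp hx b hb
    (fun i => (polyPolyEquiv F f).coeff i) ⟨r, hrq⟩ (r * q + s * (q + 1)) har
    (by simp only [hnat]; ring) (fun i hi hi0 => hweight i _ (by omega) (by omega)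
      (fun h => hi (Fin.ext (congrArg Prod.fst h))) (Polynomial.leadingCoeff_ne_zero.2 hi0))
  rw [← hsum] at hnorm0 hnorm
  have hf0 : AdjoinRoot.mk g (polyPolyEquiv F f) ≠ 0 := by
    intro h
    rw [h] at hnorm0
    have : Nontrivial (AdjoinRoot g) := inferInstance
    have := Module.Finite.of_basis b
    have := Module.Free.of_basis b
    exact hnorm0 Algebra.norm_zero
  let φ : MvPolynomial (Fin 2) F →ₐ[F] AdjoinRoot g :=
    ((AdjoinRoot.mkₐ g).restrictScalars F).comp (polyPolyEquiv F : _ →ₐ[F] _)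
  have hker : RingHom.ker φ = Ideal.span {Hpoly F q} := by
    ext p
    rw [RingHom.mem_ker, Ideal.mem_span_singleton, ← map_dvd_iff (polyPolyEquiv F)]
    exact AdjoinRoot.mk_eq_zero
  let e := quotientSpanPairEquiv φ
    (AdjoinRoot.mk_surjective.comp (polyPolyEquiv F).surjective) (Hpoly F q) f hker
  have : FiniteDimensional F (AdjoinRoot g ⧸ Ideal.span {φ f}) :=
    finite_quotient_span_singleton b hf0
  refine ⟨Module.Finite.equiv e.symm.toLinearEquiv, ?_⟩
  rw [e.toLinearEquiv.finrank_eq, ← hnorm]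
  exact finrank_quotient_span_eq_natDegree_norm b hf0
end
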